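/- arXiv:2603.16135 — 2 statements merged into one kernel-verified Lean document; each statement's English description precedes it below -/
import Mathlib

section
/- Suppose that Ω is a bounded convex domain in ℝⁿ. Then the first nonzero Neumann eigenvalue of the Laplacian satisfies μ_1(Ω) ≥ π² / (Diam Ω)². -/
open MeasureTheory

/-- The `k`-th Neumann eigenvalue of the Laplacian on `Ω ⊆ ℝⁿ`, defined via the
Courant–Fischer min-max principle: the infimum over `(k+1)`-dimensional spaces `V`
of test functions (smooth functions, distinguished by their restrictions to `Ω`)
of the supremum of the Rayleigh quotient `∫_Ω ‖∇f‖² / ∫_Ω f²` over nonzero `f ∈ V`. -/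
noncomputable def neumannEigenvalue (n : ℕ) (k : ℕ)
    (Ω : Set (EuclideanSpace ℝ (Fin n))) : ℝ :=
  ⨅ V : {V : Submodule ℝ (EuclideanSpace ℝ (Fin n) → ℝ) //
      Module.finrank ℝ V = k + 1 ∧ (∀ f ∈ V, ContDiff ℝ (⊤ : ℕ∞) f) ∧
      ∀ f ∈ V, (∀ x ∈ Ω, f x = 0) → f = 0},
    ⨆ f : {f : EuclideanSpace ℝ (Fin n) → ℝ // f ∈ V.1 ∧ f ≠ 0},
      (∫ x in Ω, ‖fderiv ℝ f.1 x‖ ^ 2) / ∫ x in Ω, (f.1 x) ^ 2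

lemma PW.oneD_smooth (h h1 h2 g g1 : ℝ → ℝ) (a b k : ℝ) (hab : a < b) (hk : 0 < k)
    (hkb : k * (b - a) < Real.pi) (hh : ∀ t, HasDerivAt h (h1 t) t)
    (hh1 : ∀ t, HasDerivAt h1 (h2 t) t)
    (hconv : ∀ t ∈ Set.Icc a b, 0 ≤ h2 t) (hg : ∀ t, HasDerivAt g (g1 t) t)
    (hg1 : Continuous g1) (hmean : ∫ t in a..b, g t * Real.exp (-h t) = 0) :
    k ^ 2 * ∫ t in a..b, g t ^ 2 * Real.exp (-h t) ≤
      ∫ t in a..b, g1 t ^ 2 * Real.exp (-h t) := by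
  have hhc : Continuous h := continuous_iff_continuousAt.2 fun t => (hh t).continuousAt
  have hgc : Continuous g := continuous_iff_continuousAt.2 fun t => (hg t).continuousAt
  set G : ℝ → ℝ := fun t => ∫ s in a..t, g s * Real.exp (-h s) with hG
  have hGd : ∀ t, HasDerivAt G (g t * Real.exp (-h t)) t := fun t =>
    intervalIntegral.integral_hasDerivAt_right
      ((by fun_prop : Continuous fun s => g s * Real.exp (-h s)).intervalIntegrable _ _)
      ((by fun_prop : Continuous fun s => g s * Real.exp (-h s)).stronglyMeasurableAtFilter _ _)
      (by fun_prop : Continuous fun s => g s * Real.exp (-h s)).continuousAt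
  have hGa : G a = 0 := by simp [hG]
  have hGb : G b = 0 := hmean
  set c := (a + b) / 2 with hc
  set T : ℝ → ℝ := fun t => Real.tan (k * (t - c)) with hT
  have hcos : ∀ t ∈ Set.Icc a b, Real.cos (k * (t - c)) ≠ 0 := by
    intro t ht
    apply ne_of_gt
    apply Real.cos_pos_of_mem_Ioo
    constructor <;> nlinarith [ht.1, ht.2, Real.pi_pos]
  have hTd : ∀ t ∈ Set.Icc a b, HasDerivAt T (k * (1 + T t ^ 2)) t := by
    intro t ht
    have h1 := Real.hasDerivAt_tan (hcos t ht)
    have h2 : HasDerivAt (fun t => k * (t - c)) k t := by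
      simpa using ((hasDerivAt_id t).sub_const c).const_mul k
    have h3 := h1.comp t h2
    convert! h3 using 1
    have := Real.inv_one_add_tan_sq (hcos t ht)
    rw [hT, one_div, ← this, inv_inv]; ring
  set ψ : ℝ → ℝ := fun t => -k * T t - h1 t / 2 with hψ
  have hψd : ∀ t ∈ Set.Icc a b, HasDerivAt ψ (-k * (k * (1 + T t ^ 2)) - h2 t / 2) t := by
    intro t ht
    exact ((hTd t ht).const_mul (-k)).sub ((hh1 t).div_const 2)
  set W : ℝ → ℝ := fun t => k ^ 2 * (G t ^ 2 * ψ t * Real.exp (h t)) - 2 * k ^ 2 * (g t * G t)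
    with hW
  have hWd : ∀ t ∈ Set.Icc a b, HasDerivAt W
      (k ^ 2 * (((2 * G t * (g t * Real.exp (-h t))) * ψ t + G t ^ 2 *
        (-k * (k * (1 + T t ^ 2)) - h2 t / 2)) * Real.exp (h t)
         + G t ^ 2 * ψ t * (Real.exp (h t) * h1 t))
        - 2 * k ^ 2 * (g1 t * G t + g t * (g t * Real.exp (-h t)))) t := by
    intro t ht
    have e1 := ((((hGd t).pow 2).mul (hψd t ht)).mul (hh t).exp).const_mul (k^2)
    have e2 := ((hg t).mul (hGd t)).const_mul (2*k^2)
    convert! e1.sub e2 using 1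
    simp
  have key := intervalIntegral.sub_le_integral_of_hasDeriv_right_of_le (g := W) (a := a) (b := b)
    (φ := fun t => g1 t ^ 2 * Real.exp (-h t) - k ^ 2 * (g t ^ 2 * Real.exp (-h t))) hab.le
    (fun t ht => (hWd t ht).continuousAt.continuousWithinAt)
    (fun t ht => (hWd t (Set.Ioo_subset_Icc_self ht)).hasDerivWithinAt)
    ((by fun_prop : Continuous fun t => g1 t ^ 2 * Real.exp (-h t) -
      k ^ 2 * (g t ^ 2 * Real.exp (-h t))).integrableOn_Icc) ?_
  · rw [intervalIntegral.integral_sub, intervalIntegral.integral_const_mul] at key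
    · have hWa : W a = 0 := by simp [hW, hGa]
      have hWb : W b = 0 := by simp [hW, hGb]
      rw [hWa, hWb] at key
      linarith
    · exact (by fun_prop : Continuous _).intervalIntegrable _ _
    · exact (by fun_prop : Continuous _).intervalIntegrable _ _
  · intro t ht
    have h2n := hconv t (Set.Ioo_subset_Icc_self ht)
    have hE : Real.exp (-h t) = (Real.exp (h t))⁻¹ := Real.exp_neg _
    have hEp := Real.exp_pos (h t)
    simp only [hE, hψ]
    set E := Real.exp (h t)
    have : g1 t ^ 2 * E⁻¹ - k ^ 2 * (g t ^ 2 * E⁻¹) - (k ^ 2 * (((2 * G t * (g t * E⁻¹)) * (-k * T t - h1 t / 2) + G t ^ 2 *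
        (-k * (k * (1 + T t ^ 2)) - h2 t / 2)) * E
         + G t ^ 2 * (-k * T t - h1 t / 2) * (E * h1 t))
        - 2 * k ^ 2 * (g1 t * G t + g t * (g t * E⁻¹))) =
        E⁻¹ * (g1 t + k ^ 2 * G t * E) ^ 2 + k ^ 2 * (E * (g t * E⁻¹ - G t * (-k * T t - h1 t / 2)) ^ 2
          + G t ^ 2 * E * (h1 t ^ 2 / 4 + h2 t / 2)) := by
      field_simp
      ring
    have h3 : 0 ≤ E⁻¹ * (g1 t + k ^ 2 * G t * E) ^ 2 + k ^ 2 * (E * (g t * E⁻¹ - G t * (-k * T t - h1 t / 2)) ^ 2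
          + G t ^ 2 * E * (h1 t ^ 2 / 4 + h2 t / 2)) := by positivity
    linarith

lemma PW.oneD_smooth_var (h h1 h2 g g1 : ℝ → ℝ) (a b k : ℝ) (hab : a < b) (hk : 0 < k)
    (hkb : k * (b - a) < Real.pi) (hh : ∀ t, HasDerivAt h (h1 t) t)
    (hh1 : ∀ t, HasDerivAt h1 (h2 t) t)
    (hconv : ∀ t ∈ Set.Icc a b, 0 ≤ h2 t) (hg : ∀ t, HasDerivAt g (g1 t) t)
    (hg1 : Continuous g1) :
    k ^ 2 * ((∫ t in a..b, Real.exp (-h t)) * (∫ t in a..b, g t ^ 2 * Real.exp (-h t)) -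
      (∫ t in a..b, g t * Real.exp (-h t)) ^ 2) ≤
      (∫ t in a..b, Real.exp (-h t)) * ∫ t in a..b, g1 t ^ 2 * Real.exp (-h t) := by
  have hhc : Continuous h := continuous_iff_continuousAt.2 fun t => (hh t).continuousAt
  have hgc : Continuous g := continuous_iff_continuousAt.2 fun t => (hg t).continuousAt
  have hPpos : 0 < ∫ t in a..b, Real.exp (-h t) :=
    intervalIntegral.intervalIntegral_pos_of_pos_on
      ((by fun_prop : Continuous fun s => Real.exp (-h s)).intervalIntegrable _ _)
      (fun t _ => Real.exp_pos _) hab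
  set P := ∫ t in a..b, Real.exp (-h t) with hP
  set Q := ∫ t in a..b, g t * Real.exp (-h t) with hQ
  set m := Q / P with hm
  have i0 : ∀ (u : ℝ → ℝ), Continuous u → IntervalIntegrable u volume a b :=
    fun u hu => hu.intervalIntegrable _ _
  have hmean : ∫ t in a..b, (g t - m) * Real.exp (-h t) = 0 := by
    simp only [sub_mul]
    rw [intervalIntegral.integral_sub (i0 _ (by fun_prop)) (i0 _ (by fun_prop)),
      intervalIntegral.integral_const_mul, ← hP, ← hQ, hm]
    field_simp
    ring
  have key := PW.oneD_smooth h h1 h2 (fun t => g t - m) g1 a b k hab hk hkb hh hh1 hconv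
    (fun t => (hg t).sub_const m) hg1 hmean
  have e : ∫ t in a..b, (g t - m) ^ 2 * Real.exp (-h t) =
      (∫ t in a..b, g t ^ 2 * Real.exp (-h t)) - 2 * m * Q + m ^ 2 * P := by
    rw [hP, hQ, ← intervalIntegral.integral_const_mul, ← intervalIntegral.integral_const_mul,
      ← intervalIntegral.integral_sub (i0 _ (by fun_prop)) (i0 _ (by fun_prop)),
      ← intervalIntegral.integral_add (i0 _ (by fun_prop)) (i0 _ (by fun_prop))]
    congr 1
    ext t
    ring
  rw [e] at key
  have := mul_le_mul_of_nonneg_left key hPpos.le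
  refine le_trans (le_of_eq ?_) this
  rw [hm]
  field_simp
  ring

/-- averaging operator -/
noncomputable def PW.avg (ε : ℝ) (u : ℝ → ℝ) (t : ℝ) : ℝ := (∫ s in t..(t + ε), u s) / ε

lemma PW.avg_hasDerivAt (ε : ℝ) (u : ℝ → ℝ) (hu : Continuous u) (t : ℝ) :
    HasDerivAt (PW.avg ε u) ((u (t + ε) - u t) / ε) t := by
  have h0 : ∀ t, HasDerivAt (fun t => ∫ s in (0:ℝ)..t, u s) (u t) t := fun t =>
    intervalIntegral.integral_hasDerivAt_right (hu.intervalIntegrable _ _)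
      (hu.stronglyMeasurableAtFilter _ _) hu.continuousAt
  have e : PW.avg ε u = fun t => ((∫ s in (0:ℝ)..(t + ε), u s) - ∫ s in (0:ℝ)..t, u s) / ε := by
    ext t
    rw [PW.avg, intervalIntegral.integral_interval_sub_left (hu.intervalIntegrable _ _)
      (hu.intervalIntegrable _ _)]
  rw [e]
  exact (((h0 (t + ε)).comp_add_const t ε).sub (h0 t)).div_const ε

lemma PW.avg_continuous (ε : ℝ) (u : ℝ → ℝ) (hu : Continuous u) : Continuous (PW.avg ε u) :=
  continuous_iff_continuousAt.2 fun t => (PW.avg_hasDerivAt ε u hu t).continuousAt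

lemma PW.avg_close (ε : ℝ) (hε : 0 < ε) (u : ℝ → ℝ) (hu : Continuous u) (t c η : ℝ)
    (h : ∀ s ∈ Set.Icc t (t + ε), |u s - c| ≤ η) : |PW.avg ε u t - c| ≤ η := by
  have h1 : PW.avg ε u t - c = (∫ s in t..(t + ε), (u s - c)) / ε := by
    rw [PW.avg, intervalIntegral.integral_sub (hu.intervalIntegrable _ _)
      (continuous_const.intervalIntegrable _ _)]
    simp
    field_simp
  have h2 := intervalIntegral.norm_integral_le_of_norm_le_const (a := t) (b := t + ε) (C := η)
    (f := fun s => u s - c) (fun s hs => by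
      rw [Set.uIoc_of_le (by linarith)] at hs
      exact h s ⟨hs.1.le, hs.2⟩)
  rw [h1, abs_div, abs_of_pos hε, div_le_iff₀ hε]
  simpa [abs_of_pos hε] using h2

lemma PW.oneD_convex (h g g1 : ℝ → ℝ) (a b b' k : ℝ) (hab : a < b) (hbb : b < b') (hk : 0 < k)
    (hkb : k * (b - a) < Real.pi) (hh : ConvexOn ℝ (Set.Icc a b') h)
    (hhc : ContinuousOn h (Set.Icc a b')) (hg : ∀ t, HasDerivAt g (g1 t) t)
    (hg1 : Continuous g1) :
    k ^ 2 * ((∫ t in a..b, Real.exp (-h t)) * (∫ t in a..b, g t ^ 2 * Real.exp (-h t)) -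
      (∫ t in a..b, g t * Real.exp (-h t)) ^ 2) ≤
      (∫ t in a..b, Real.exp (-h t)) * ∫ t in a..b, g1 t ^ 2 * Real.exp (-h t) := by
  have hab' : a ≤ b' := by linarith
  have hgc : Continuous g := continuous_iff_continuousAt.2 fun t => (hg t).continuousAt
  set u : ℝ → ℝ := Set.IccExtend hab' ((Set.Icc a b').domRestrict h) with hu
  have huc : Continuous u := by
    apply Continuous.Icc_extend'
    exact continuousOn_iff_continuous_domRestrict.1 hhc
  have hue : ∀ t ∈ Set.Icc a b', u t = h t := by
    intro t ht
    rw [hu, Set.IccExtend_of_mem _ _ ht]; rfl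
  obtain ⟨M, hM⟩ : ∃ M, ∀ t, |u t| ≤ M := by
    obtain ⟨M, hM⟩ := (isCompact_Icc (a := a) (b := b')).exists_bound_of_continuousOn hhc
    refine ⟨M, fun t => ?_⟩
    exact hM _ (Set.projIcc a b' hab' t).2
  set v : ℝ → ℝ → ℝ := fun ε => PW.avg ε (PW.avg ε u) with hv
  have hvc : ∀ ε, Continuous (v ε) := fun ε => PW.avg_continuous _ _ (PW.avg_continuous _ _ huc)
  have hvM : ∀ ε, 0 < ε → ∀ t, |v ε t| ≤ M := by
    intro ε hε t
    have := PW.avg_close ε hε _ (PW.avg_continuous ε u huc) t 0 M (fun s _ => by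
      have := PW.avg_close ε hε u huc s 0 M (fun r _ => by simpa using hM r)
      simpa using this)
    simpa using this
  have hvt : ∀ t, Filter.Tendsto (fun ε => v ε t) (nhdsWithin 0 (Set.Ioi 0)) (nhds (u t)) := by
    intro t
    rw [Metric.tendsto_nhds]
    intro η hη
    obtain ⟨δ, hδ, hd⟩ := Metric.continuousAt_iff.1 (huc.continuousAt (x := t)) (η/2) (by positivity)
    have : Set.Ioo (0:ℝ) (δ/2) ∈ nhdsWithin (0:ℝ) (Set.Ioi 0) := Ioo_mem_nhdsGT (by positivity)
    filter_upwards [this] with ε hε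
    have h1 := PW.avg_close ε hε.1 _ (PW.avg_continuous ε u huc) t (u t) (η/2) (fun s hs =>
      PW.avg_close ε hε.1 u huc s (u t) (η/2) (fun r hr => by
        have := hd (x := r) (by
          rw [Real.dist_eq, abs_lt]
          constructor <;> linarith [hs.1, hs.2, hr.1, hr.2, hε.1, hε.2])
        exact this.le))
    rw [Real.dist_eq]
    change |v ε t - u t| ≤ _ at h1
    linarith
  have hlim : ∀ q : ℝ → ℝ, Continuous q → Filter.Tendsto
      (fun ε => ∫ t in a..b, q t * Real.exp (-v ε t)) (nhdsWithin 0 (Set.Ioi 0))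
      (nhds (∫ t in a..b, q t * Real.exp (-h t))) := by
    intro q hq
    have e : ∫ t in a..b, q t * Real.exp (-h t) = ∫ t in a..b, q t * Real.exp (-u t) := by
      apply intervalIntegral.integral_congr
      intro t ht
      rw [Set.uIcc_of_le hab.le] at ht
      simp only
      rw [hue t ⟨ht.1, ht.2.trans hbb.le⟩]
    rw [e]
    apply intervalIntegral.tendsto_integral_filter_of_dominated_convergence
      (fun t => |q t| * Real.exp M)
    · refine Filter.Eventually.of_forall fun ε => ?_
      have := hvc ε
      exact (by fun_prop : Continuous _).aestronglyMeasurable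
    · filter_upwards [self_mem_nhdsWithin] with ε hε
      refine Filter.Eventually.of_forall fun t _ => ?_
      rw [norm_mul, Real.norm_eq_abs, Real.norm_eq_abs, Real.abs_exp]
      gcongr
      have := neg_abs_le (v ε t)
      linarith [hvM ε hε t]
    · exact (by fun_prop : Continuous _).intervalIntegrable _ _
    · refine Filter.Eventually.of_forall fun t _ => ?_
      exact ((hvt t).neg.rexp).const_mul _
  have l0 := hlim (fun _ => 1) continuous_const
  have l1 := hlim g hgc
  have l2 := hlim (fun t => g t ^ 2) (by fun_prop)
  have l3 := hlim (fun t => g1 t ^ 2) (by fun_prop)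
  simp only [one_mul] at l0
  refine le_of_tendsto_of_tendsto (((l0.mul l2).sub (l1.pow 2)).const_mul (k ^ 2)) (l0.mul l3) ?_
  have : Set.Ioo (0:ℝ) ((b' - b)/2) ∈ nhdsWithin (0:ℝ) (Set.Ioi 0) :=
    Ioo_mem_nhdsGT (by linarith)
  filter_upwards [this] with ε hε
  refine PW.oneD_smooth_var (v ε) (fun t => (PW.avg ε u (t + ε) - PW.avg ε u t) / ε)
    (fun t => ((u (t + ε + ε) - u (t + ε)) / ε - (u (t + ε) - u t) / ε) / ε) g g1 a b k hab hk hkb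
    (fun t => PW.avg_hasDerivAt _ _ (PW.avg_continuous _ _ huc) t)
    (fun t => (((PW.avg_hasDerivAt ε u huc (t + ε)).comp_add_const t ε).sub
      (PW.avg_hasDerivAt ε u huc t)).div_const ε) ?_ hg hg1
  intro t ht
  have hε0 := hε.1
  have hε2 := hε.2
  have m1 : t ∈ Set.Icc a b' := ⟨ht.1, by linarith [ht.2]⟩
  have m2 : t + ε ∈ Set.Icc a b' := ⟨by linarith [ht.1], by linarith [ht.2]⟩
  have m3 : t + ε + ε ∈ Set.Icc a b' := ⟨by linarith [ht.1], by linarith [ht.2]⟩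
  rw [hue _ m1, hue _ m2, hue _ m3]
  have := hh.2 m1 m3 (by norm_num : (0:ℝ) ≤ 1/2) (by norm_num : (0:ℝ) ≤ 1/2) (by norm_num)
  simp only [smul_eq_mul] at this
  rw [show 1 / 2 * t + 1 / 2 * (t + ε + ε) = t + ε by ring] at this
  rw [← sub_div, div_div]
  apply div_nonneg _ (by positivity)
  linarith

lemma PW.oneD_logconcave (p g g1 : ℝ → ℝ) (a b k : ℝ) (hab : a < b) (hk : 0 < k)
    (hkb : k * (b - a) < Real.pi) (hp : ∀ t ∈ Set.Ioo a b, 0 < p t)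
    (hh : ConvexOn ℝ (Set.Ioo a b) (fun t => -Real.log (p t)))
    (hpi : IntegrableOn p (Set.Ioo a b)) (hg : ∀ t, HasDerivAt g (g1 t) t)
    (hg1 : Continuous g1) :
    k ^ 2 * ((∫ t in Set.Ioo a b, p t) * (∫ t in Set.Ioo a b, g t ^ 2 * p t) -
      (∫ t in Set.Ioo a b, g t * p t) ^ 2) ≤
      (∫ t in Set.Ioo a b, p t) * ∫ t in Set.Ioo a b, g1 t ^ 2 * p t := by
  have hgc : Continuous g := continuous_iff_continuousAt.2 fun t => (hg t).continuousAt
  have hhc := hh.continuousOn isOpen_Ioo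
  set L := b - a with hL
  have hLp : 0 < L := by linarith
  have t1 : Filter.Tendsto (fun ε : ℝ => a + ε) (nhdsWithin 0 (Set.Ioi 0)) (nhds a) := by
    have : Filter.Tendsto (fun ε : ℝ => a + ε) (nhds 0) (nhds (a + 0)) :=
      (continuous_const.add continuous_id).tendsto 0
    rw [add_zero] at this
    exact this.mono_left nhdsWithin_le_nhds
  have t2 : Filter.Tendsto (fun ε : ℝ => b - ε) (nhdsWithin 0 (Set.Ioi 0)) (nhds b) := by
    have : Filter.Tendsto (fun ε : ℝ => b - ε) (nhds 0) (nhds (b - 0)) :=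
      (continuous_const.sub continuous_id).tendsto 0
    rw [sub_zero] at this
    exact this.mono_left nhdsWithin_le_nhds
  have hmem : Set.Ioo (0:ℝ) (L/2) ∈ nhdsWithin (0:ℝ) (Set.Ioi 0) :=
    Ioo_mem_nhdsGT (by linarith)
  have hlim : ∀ q : ℝ → ℝ, Continuous q → Filter.Tendsto
      (fun ε => ∫ t in (a + ε)..(b - ε), q t * p t) (nhdsWithin 0 (Set.Ioi 0))
      (nhds (∫ t in Set.Ioo a b, q t * p t)) := by
    intro q hq
    have hIntg : IntegrableOn (fun t => q t * p t) (Set.Ioo a b) := by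
      obtain ⟨M, hM⟩ := (isCompact_Icc (a := a) (b := b)).exists_bound_of_continuousOn hq.continuousOn
      refine Integrable.bdd_mul (c := M) hpi hq.aestronglyMeasurable ?_
      filter_upwards [ae_restrict_mem measurableSet_Ioo] with t ht
      exact hM t (Set.Ioo_subset_Icc_self ht)
    have hc := aecover_Ioo_of_Ioc (μ := volume) (A := a) (B := b) t1 t2
    have := hc.integral_tendsto_of_countably_generated hIntg
    refine this.congr' ?_
    filter_upwards [hmem] with ε hε
    rw [intervalIntegral.integral_of_le (by linarith [hε.1, hε.2]), Measure.restrict_restrict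
      measurableSet_Ioc, Set.inter_eq_left.2]
    intro t ht
    exact ⟨by linarith [ht.1, hε.1], by linarith [ht.2, hε.1]⟩
  have l0 := hlim (fun _ => 1) continuous_const
  have l1 := hlim g hgc
  have l2 := hlim (fun t => g t ^ 2) (by fun_prop)
  have l3 := hlim (fun t => g1 t ^ 2) (by fun_prop)
  simp only [one_mul] at l0
  refine le_of_tendsto_of_tendsto (((l0.mul l2).sub (l1.pow 2)).const_mul (k ^ 2)) (l0.mul l3) ?_
  filter_upwards [hmem] with ε hε
  have hε0 := hε.1
  have hε2 := hε.2
  have hsub : Set.Icc (a + ε) (b - ε / 2) ⊆ Set.Ioo a b := by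
    intro t ht
    exact ⟨by linarith [ht.1], by linarith [ht.2]⟩
  have key := PW.oneD_convex (fun t => -Real.log (p t)) g g1 (a + ε) (b - ε) (b - ε / 2) k
    (by linarith) (by linarith) hk (by nlinarith) (hh.subset hsub (convex_Icc _ _))
    (hhc.mono hsub) hg hg1
  have hcongr : ∀ q : ℝ → ℝ, ∫ t in (a + ε)..(b - ε), q t * Real.exp (- - Real.log (p t)) =
      ∫ t in (a + ε)..(b - ε), q t * p t := by
    intro q
    apply intervalIntegral.integral_congr
    intro t ht
    rw [Set.uIcc_of_le (by linarith)] at ht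
    simp only [neg_neg]
    rw [Real.exp_log (hp t ⟨by linarith [ht.1], by linarith [ht.2]⟩)]
  have c0 := hcongr (fun _ => 1)
  simp only [one_mul] at c0
  rw [c0, hcongr g, hcongr (fun t => g t ^ 2), hcongr (fun t => g1 t ^ 2)] at key
  exact key

open scoped ENNReal in
lemma PW.bm_compact (A B C : Set ℝ) (hA : IsCompact A) (hB : IsCompact B) (hA0 : A.Nonempty)
    (hB0 : B.Nonempty) (h : ∀ x ∈ A, ∀ y ∈ B, x + y ∈ C) :
    volume A + volume B ≤ volume C := by
  have hM := hA.sSup_mem hA0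
  have hm := hB.sInf_mem hB0
  set M := sSup A
  set m := sInf B
  have e1 : volume A = volume ((fun x => x + m) '' A) := by
    rw [Set.image_add_right, measure_preimage_add_right]
  have e2 : volume B = volume (((fun x => M + x) '' B) \ {M + m}) := by
    rw [measure_sdiff_null (by simp), Set.image_add_left, measure_preimage_add]
  rw [e1, e2, ← measure_union]
  · apply measure_mono
    rintro _ (⟨x, hx, rfl⟩ | ⟨⟨x, hx, rfl⟩, -⟩)
    · exact h x hx m hm
    · exact h M hM x hx
  · rw [Set.disjoint_left]
    rintro _ ⟨x, hx, rfl⟩ ⟨⟨y, hy, hxy⟩, hne⟩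
    have h1 : x ≤ M := le_csSup hA.bddAbove hx
    have h2 : m ≤ y := csInf_le hB.bddBelow hy
    apply hne
    simp only at hxy
    simp only [Set.mem_singleton_iff]
    linarith
  · exact ((hB.image (by fun_prop)).measurableSet).diff (measurableSet_singleton _)

lemma PW.bm (A B C : Set ℝ) (hA : MeasurableSet A) (hB : MeasurableSet B) (hA0 : A.Nonempty)
    (hB0 : B.Nonempty) (h : ∀ x ∈ A, ∀ y ∈ B, x + y ∈ C) :
    volume A + volume B ≤ volume C := by
  by_contra! hlt
  obtain ⟨a0, ha0⟩ := hA0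
  obtain ⟨b0, hb0⟩ := hB0
  have hA' : ∀ K, IsCompact K → K ⊆ A → volume K + volume B ≤ volume C := by
    intro K hK hKA
    by_contra! hlt2
    have : ∃ L, IsCompact L ∧ L ⊆ B ∧ volume C < volume K + volume L := by
      rw [hB.measure_eq_iSup_isCompact, ENNReal.add_iSup] at hlt2
      · rw [lt_iSup_iff] at hlt2
        obtain ⟨L, hL⟩ := hlt2
        by_cases hLB : L ⊆ B
        · by_cases hLc : IsCompact L
          · exact ⟨L, hLc, hLB, by simpa [hLB, hLc] using hL⟩
          · exact ⟨∅, isCompact_empty, by simp, by simpa [hLc] using hL⟩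
        · exact ⟨∅, isCompact_empty, by simp, by simpa [hLB] using hL⟩
    obtain ⟨L, hL, hLB, hlt3⟩ := this
    have := PW.bm_compact (K ∪ {a0}) (L ∪ {b0}) C (hK.union isCompact_singleton)
      (hL.union isCompact_singleton) ⟨a0, by simp⟩ ⟨b0, by simp⟩ (by
        intro x hx y hy
        apply h
        · rcases hx with hx | rfl
          exacts [hKA hx, ha0]
        · rcases hy with hy | rfl
          exacts [hLB hy, hb0])
    exact absurd (this.trans_lt hlt3) (not_lt.2 (add_le_add (measure_mono Set.subset_union_left)
      (measure_mono Set.subset_union_left)))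
  rw [hA.measure_eq_iSup_isCompact, ENNReal.iSup_add, lt_iSup_iff] at hlt
  obtain ⟨K, hK⟩ := hlt
  by_cases hKA : K ⊆ A
  · by_cases hKc : IsCompact K
    · have := hA' K hKc hKA
      simp [hKA, hKc] at hK
      exact absurd hK (not_lt.2 this)
    · have := hA' ∅ isCompact_empty (by simp)
      simp [hKc] at hK
      simp at this
      exact absurd hK (not_lt.2 this)
  · have := hA' ∅ isCompact_empty (by simp)
    simp [hKA] at hK
    simp at this
    exact absurd hK (not_lt.2 this)

lemma PW.pl_normalized (α β : ℝ) (hα : 0 < α) (hβ : 0 < β) (f g h : ℝ → ℝ)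
    (hf : Measurable f) (hg : Measurable g) (hh : Measurable h)
    (hf0 : ∀ x, 0 ≤ f x) (hg0 : ∀ x, 0 ≤ g x) (hh0 : ∀ x, 0 ≤ h x)
    (hf1 : ∀ x, f x ≤ 1) (hg1 : ∀ x, g x ≤ 1)
    (hfs : ∀ t < 1, ∃ x, t < f x) (hgs : ∀ t < 1, ∃ x, t < g x)
    (H : ∀ t, 0 < t → ∀ x y, t < f x → t < g y → t < h (α * x + β * y)) :
    ENNReal.ofReal α * (∫⁻ x, ENNReal.ofReal (f x)) + ENNReal.ofReal β *
      (∫⁻ x, ENNReal.ofReal (g x)) ≤ ∫⁻ x, ENNReal.ofReal (h x) := by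
  rw [lintegral_eq_lintegral_meas_lt volume (Filter.Eventually.of_forall hf0) hf.aemeasurable,
    lintegral_eq_lintegral_meas_lt volume (Filter.Eventually.of_forall hg0) hg.aemeasurable,
    lintegral_eq_lintegral_meas_lt volume (Filter.Eventually.of_forall hh0) hh.aemeasurable,
    ← lintegral_const_mul' _ _ ENNReal.ofReal_ne_top,
    ← lintegral_const_mul' _ _ ENNReal.ofReal_ne_top, ← lintegral_add_left]
  · apply setLIntegral_mono' measurableSet_Ioi
    intro t ht
    by_cases ht1 : t < 1
    · have e1 : ENNReal.ofReal α * volume {a | t < f a} =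
          volume ((fun x => α⁻¹ * x) ⁻¹' {a | t < f a}) := by
        rw [Real.volume_preimage_mul_left (by positivity), inv_inv, abs_of_pos hα]
      have e2 : ENNReal.ofReal β * volume {a | t < g a} =
          volume ((fun x => β⁻¹ * x) ⁻¹' {a | t < g a}) := by
        rw [Real.volume_preimage_mul_left (by positivity), inv_inv, abs_of_pos hβ]
      rw [e1, e2]
      apply PW.bm
      · exact (by fun_prop : Measurable fun x => α⁻¹ * x) (measurableSet_lt measurable_const hf)
      · exact (by fun_prop : Measurable fun x => β⁻¹ * x) (measurableSet_lt measurable_const hg)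
      · obtain ⟨x, hx⟩ := hfs t ht1
        exact ⟨α * x, by simpa [← mul_assoc, inv_mul_cancel₀ hα.ne'] using hx⟩
      · obtain ⟨x, hx⟩ := hgs t ht1
        exact ⟨β * x, by simpa [← mul_assoc, inv_mul_cancel₀ hβ.ne'] using hx⟩
      · intro x hx y hy
        have := H t ht _ _ hx hy
        simpa [← mul_assoc, mul_inv_cancel₀ hα.ne', mul_inv_cancel₀ hβ.ne'] using this
    · have e1 : {a | t < f a} = ∅ := by
        ext x; simp only [Set.mem_ofPred_eq, Set.mem_empty_iff_false, iff_false]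
        linarith [hf1 x]
      have e2 : {a | t < g a} = ∅ := by
        ext x; simp only [Set.mem_ofPred_eq, Set.mem_empty_iff_false, iff_false]
        linarith [hg1 x]
      simp [e1, e2]
  · have : Antitone fun t => volume {a | t < f a} := fun s t hst =>
      measure_mono fun x hx => lt_of_le_of_lt hst hx
    exact this.measurable.const_mul _

open scoped ENNReal in
lemma PW.ennreal_amgm (α β : ℝ) (hα : 0 < α) (hβ : 0 < β) (hαβ : α + β = 1) (x y : ℝ≥0∞) :
    x ^ α * y ^ β ≤ ENNReal.ofReal α * x + ENNReal.ofReal β * y := by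
  have ha : ENNReal.ofReal α ≠ 0 := by simpa using hα
  have hb : ENNReal.ofReal β ≠ 0 := by simpa using hβ
  by_cases hx : x = ⊤
  · simp [hx, ENNReal.mul_top ha]
  by_cases hy : y = ⊤
  · simp [hy, ENNReal.mul_top hb]
  lift x to NNReal using hx
  lift y to NNReal using hy
  have := NNReal.geom_mean_le_arith_mean2_weighted ⟨α, hα.le⟩ ⟨β, hβ.le⟩ x y
    (by ext; exact hαβ)
  rw [← ENNReal.coe_rpow_of_nonneg _ hα.le, ← ENNReal.coe_rpow_of_nonneg _ hβ.le,
    ENNReal.ofReal_eq_coe_nnreal hα.le, ENNReal.ofReal_eq_coe_nnreal hβ.le]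
  exact_mod_cast this

open scoped ENNReal in
lemma PW.pl_one (α β : ℝ) (hα : 0 < α) (hβ : 0 < β) (hαβ : α + β = 1) (f g h : ℝ → ℝ≥0∞)
    (hf : Measurable f) (hg : Measurable g) (hh : Measurable h) (C : ℝ≥0∞) (hC : C ≠ ⊤)
    (hfC : ∀ x, f x ≤ C) (hgC : ∀ x, g x ≤ C)
    (H : ∀ x y, f x ^ α * g y ^ β ≤ h (α * x + β * y)) :
    (∫⁻ x, f x) ^ α * (∫⁻ x, g x) ^ β ≤ ∫⁻ x, h x := by
  set a := ⨆ x, f x with ha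
  set b := ⨆ x, g x with hb
  have hfa : ∀ x, f x ≤ a := fun x => le_iSup f x
  have hgb : ∀ x, g x ≤ b := fun x => le_iSup g x
  have hat : a ≠ ⊤ := ne_top_of_le_ne_top hC (iSup_le hfC)
  have hbt : b ≠ ⊤ := ne_top_of_le_ne_top hC (iSup_le hgC)
  by_cases ha0 : a = 0
  · have : ∀ x, f x = 0 := fun x => by simpa [ha0] using hfa x
    simp [this, ENNReal.zero_rpow_of_pos hα]
  by_cases hb0 : b = 0
  · have : ∀ x, g x = 0 := fun x => by simpa [hb0] using hgb x
    simp [this, ENNReal.zero_rpow_of_pos hβ]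
  set c := a ^ α * b ^ β with hc
  have hc0 : c ≠ 0 := mul_ne_zero (by simp [ENNReal.rpow_eq_zero_iff, ha0, hat])
    (by simp [ENNReal.rpow_eq_zero_iff, hb0, hbt])
  have hct : c ≠ ⊤ := ENNReal.mul_ne_top (ENNReal.rpow_ne_top_of_nonneg hα.le hat)
    (ENNReal.rpow_ne_top_of_nonneg hβ.le hbt)
  have f1 : ∀ x, f x / a ≤ 1 := fun x => ENNReal.div_le_of_le_mul (by simpa using hfa x)
  have g1 : ∀ x, g x / b ≤ 1 := fun x => ENNReal.div_le_of_le_mul (by simpa using hgb x)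
  have ft : ∀ x, f x / a ≠ ⊤ := fun x => ne_top_of_le_ne_top ENNReal.one_ne_top (f1 x)
  have gt : ∀ x, g x / b ≠ ⊤ := fun x => ne_top_of_le_ne_top ENNReal.one_ne_top (g1 x)
  have ht : ∀ x, min (h x / c) 1 ≠ ⊤ := fun x =>
    ne_top_of_le_ne_top ENNReal.one_ne_top (min_le_right _ _)
  have sup : ∀ (φ : ℝ → ℝ≥0∞) (s : ℝ≥0∞), s = ⨆ x, φ x → s ≠ 0 → s ≠ ⊤ →
      (∀ x, φ x / s ≠ ⊤) → ∀ t < (1:ℝ), ∃ x, t < (φ x / s).toReal := by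
    intro φ s hs hs0 hst hφ t ht
    by_cases ht0 : t < 0
    · exact ⟨0, ht0.trans_le ENNReal.toReal_nonneg⟩
    push Not at ht0
    have : ENNReal.ofReal t * s < ⨆ x, φ x := by
      rw [← hs]
      calc ENNReal.ofReal t * s < 1 * s := by
            apply ENNReal.mul_lt_mul_left hs0 hst
            simpa using ht
        _ = s := one_mul _
    obtain ⟨x, hx⟩ := lt_iSup_iff.1 this
    refine ⟨x, (ENNReal.ofReal_lt_iff_lt_toReal ht0 (hφ x)).1 ?_⟩
    exact (ENNReal.lt_div_iff_mul_lt (Or.inl hs0) (Or.inl hst)).2 hx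
  have key := PW.pl_normalized α β hα hβ (fun x => (f x / a).toReal) (fun x => (g x / b).toReal)
    (fun x => (min (h x / c) 1).toReal) (hf.div_const _).ennreal_toReal
    (hg.div_const _).ennreal_toReal ((hh.div_const _).min measurable_const).ennreal_toReal
    (fun _ => ENNReal.toReal_nonneg) (fun _ => ENNReal.toReal_nonneg)
    (fun _ => ENNReal.toReal_nonneg)
    (fun x => ENNReal.toReal_le_of_le_ofReal zero_le_one (by simpa using f1 x))
    (fun x => ENNReal.toReal_le_of_le_ofReal zero_le_one (by simpa using g1 x))
    (sup f a ha ha0 hat ft) (sup g b hb hb0 hbt gt) ?_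
  · simp only [ENNReal.ofReal_toReal (ft _), ENNReal.ofReal_toReal (gt _),
      ENNReal.ofReal_toReal (ht _)] at key
    have e1 : ∫⁻ x, f x = a * ∫⁻ x, f x / a := by
      rw [← lintegral_const_mul' _ _ hat]
      congr 1; ext x
      exact (ENNReal.mul_div_cancel ha0 hat).symm
    have e2 : ∫⁻ x, g x = b * ∫⁻ x, g x / b := by
      rw [← lintegral_const_mul' _ _ hbt]
      congr 1; ext x
      exact (ENNReal.mul_div_cancel hb0 hbt).symm
    have e3 : ∫⁻ x, h x = c * ∫⁻ x, h x / c := by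
      rw [← lintegral_const_mul' _ _ hct]
      congr 1; ext x
      exact (ENNReal.mul_div_cancel hc0 hct).symm
    rw [e1, e2, e3, ENNReal.mul_rpow_of_nonneg _ _ hα.le, ENNReal.mul_rpow_of_nonneg _ _ hβ.le,
      mul_mul_mul_comm]
    refine mul_le_mul_right ?_ _
    calc _ ≤ _ := PW.ennreal_amgm α β hα hβ hαβ _ _
      _ ≤ _ := key
      _ ≤ _ := lintegral_mono fun x => min_le_left _ _
  · intro t ht0 x y hx hy
    have hx' := (ENNReal.ofReal_lt_iff_lt_toReal ht0.le (ft x)).2 hx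
    have hy' := (ENNReal.ofReal_lt_iff_lt_toReal ht0.le (gt y)).2 hy
    refine (ENNReal.ofReal_lt_iff_lt_toReal ht0.le (ht _)).1 ?_
    refine lt_min ?_ (hx'.trans_le (f1 x))
    calc ENNReal.ofReal t = ENNReal.ofReal t ^ α * ENNReal.ofReal t ^ β := by
          rw [← ENNReal.rpow_add_of_nonneg _ _ hα.le hβ.le, hαβ, ENNReal.rpow_one]
      _ < (f x / a) ^ α * (g y / b) ^ β :=
          ENNReal.mul_lt_mul (ENNReal.rpow_lt_rpow hx' hα) (ENNReal.rpow_lt_rpow hy' hβ)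
      _ = (f x ^ α * g y ^ β) / c := by
          rw [ENNReal.div_rpow_of_nonneg _ _ hα.le, ENNReal.div_rpow_of_nonneg _ _ hβ.le, hc,
            div_eq_mul_inv, div_eq_mul_inv, div_eq_mul_inv, ENNReal.mul_inv, mul_mul_mul_comm]
          · exact Or.inr (ENNReal.rpow_ne_top_of_nonneg hβ.le hbt)
          · exact Or.inl (ENNReal.rpow_ne_top_of_nonneg hα.le hat)
      _ ≤ h (α * x + β * y) / c := ENNReal.div_le_div_right (H x y) c

open scoped ENNReal in
lemma PW.marginal (α β : ℝ) (hα : 0 < α) (hβ : 0 < β) (hαβ : α + β = 1) (R : ℝ) (m : ℕ) :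
    ∀ (F : ℝ → (Fin m → ℝ) → ℝ≥0∞) (C : ℝ≥0∞), Measurable (Function.uncurry F) → C ≠ ⊤ →
      (∀ x y, F x y ≤ C) → (∀ x y i, R < |y i| → F x y = 0) →
      (∀ x x' y y', F x y ^ α * F x' y' ^ β ≤ F (α * x + β * x') (α • y + β • y')) →
      ∀ x x', (∫⁻ y, F x y) ^ α * (∫⁻ y, F x' y) ^ β ≤ ∫⁻ y, F (α * x + β * x') y := by
  induction m with
  | zero =>
    intro F C _ _ _ _ hlc x x'
    simp only [lintegral_unique, volume_pi, Measure.pi_univ, Finset.univ_eq_empty,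
      Finset.prod_empty, mul_one]
    refine (hlc x x' _ _).trans (le_of_eq ?_)
    congr 1
    exact Subsingleton.elim _ _
  | succ m ih =>
    intro F C hF hC hFC hFR hlc x x'
    have hFx : ∀ x, Measurable (F x) := fun x => hF.comp measurable_prodMk_left
    have hsymm : ∀ z : ℝ × (Fin m → ℝ), (MeasurableEquiv.piFinSuccAbove (fun _ => ℝ) 0).symm z
        = (Fin.cons z.1 z.2 : Fin (m + 1) → ℝ) := by
      intro z
      have := Fin.insertNth_zero (α := fun _ : Fin (m + 1) => ℝ) z.1 z.2
      exact this
    have hcons : Measurable fun z : ℝ × (Fin m → ℝ) => (Fin.cons z.1 z.2 : Fin (m + 1) → ℝ) := by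
      have := (MeasurableEquiv.piFinSuccAbove (fun _ : Fin (m + 1) => ℝ) 0).symm.measurable
      simpa only [← hsymm] using this
    have e : ∀ x, ∫⁻ y, F x y = ∫⁻ y', ∫⁻ y0, F x (Fin.cons y0 y' : Fin (m + 1) → ℝ) := by
      intro x
      have mp := (volume_preserving_piFinSuccAbove (fun _ : Fin (m + 1) => ℝ) 0).symm
      rw [← mp.lintegral_comp (hFx x), Measure.volume_eq_prod, lintegral_prod_symm]
      · simp only [hsymm]
      · exact ((hFx x).comp mp.measurable).aemeasurable
    rw [e, e, e]
    refine ih (fun x y' => ∫⁻ y0, F x (Fin.cons y0 y' : Fin (m + 1) → ℝ))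
      (C * ENNReal.ofReal (R - -R)) ?_ ?_ ?_ ?_ ?_ x x'
    · refine Measurable.lintegral_prod_right'
        (f := fun z : (ℝ × (Fin m → ℝ)) × ℝ => F z.1.1 (Fin.cons z.2 z.1.2 : Fin (m + 1) → ℝ)) ?_
      refine hF.comp (Measurable.prodMk (by fun_prop) ?_)
      exact hcons.comp (by fun_prop : Measurable fun z : (ℝ × (Fin m → ℝ)) × ℝ => (z.2, z.1.2))
    · exact ENNReal.mul_ne_top hC ENNReal.ofReal_ne_top
    · intro x y'
      rw [← Real.volume_Icc, ← setLIntegral_const, ← lintegral_indicator measurableSet_Icc]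
      apply lintegral_mono
      intro y0
      by_cases h0 : y0 ∈ Set.Icc (-R) R
      · simp only [Set.indicator_of_mem h0]; exact hFC _ _
      · have : R < |y0| := by
          by_contra! h1
          exact h0 (abs_le.1 h1)
        simp only
        rw [hFR x (Fin.cons y0 y' : Fin (m + 1) → ℝ) 0 (by simpa using this)]
        exact zero_le
    · intro x y' i hi
      have : ∀ y0, F x (Fin.cons y0 y' : Fin (m + 1) → ℝ) = 0 := fun y0 =>
        hFR x _ i.succ (by simpa using hi)
      simp [this]
    · intro x x' y y'
      have hs : ∀ x (y : Fin m → ℝ), Measurable fun y0 => F x (Fin.cons y0 y : Fin (m + 1) → ℝ) :=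
        fun x y => (hFx x).comp (hcons.comp (by fun_prop : Measurable fun z : ℝ => (z, y)))
      refine PW.pl_one α β hα hβ hαβ _ _ _ (hs _ _) (hs _ _) (hs _ _) C hC (fun _ => hFC _ _)
        (fun _ => hFC _ _) ?_
      intro s t
      refine (hlc x x' _ _).trans (le_of_eq ?_)
      congr 1
      ext i
      refine Fin.cases ?_ (fun i => ?_) i <;> simp

/-- Measure-preserving linear coordinates whose first coordinate is `⟪e, x⟫`. -/
lemma PW.exists_coords (m : ℕ) (e : EuclideanSpace ℝ (Fin (m + 1))) (he : ‖e‖ = 1) :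
    ∃ Θ : (ℝ × (Fin m → ℝ)) ≃L[ℝ] EuclideanSpace ℝ (Fin (m + 1)),
      MeasurePreserving Θ volume volume ∧ (∀ z, inner ℝ e (Θ z) = z.1) ∧
      ∀ z i, |z.2 i| ≤ ‖Θ z‖ := by
  obtain ⟨b, hb⟩ := Orthonormal.exists_orthonormalBasis_extension_of_card_eq (𝕜 := ℝ)
    (E := EuclideanSpace ℝ (Fin (m + 1))) (ι := Fin (m + 1)) (by simp)
    (v := fun _ => e) (s := {0}) (by
      constructor
      · intro i; simpa using he
      · intro i j hij; exact absurd (Subsingleton.elim i j) hij)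
  have hb0 : b 0 = e := hb 0 rfl
  let L1 : (ℝ × (Fin m → ℝ)) ≃L[ℝ] (Fin (m + 1) → ℝ) :=
    Fin.consEquivL ℝ (fun _ : Fin (m + 1) => ℝ)
  let L2 : (Fin (m + 1) → ℝ) ≃L[ℝ] EuclideanSpace ℝ (Fin (m + 1)) :=
    (EuclideanSpace.equiv (Fin (m + 1)) ℝ).symm
  have hΘ : ∀ z i, b.repr (((L1.trans L2).trans b.repr.symm.toContinuousLinearEquiv) z) i =
      (Fin.cons z.1 z.2 : Fin (m + 1) → ℝ) i := by
    intro z i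
    simp [L1, L2]
  refine ⟨(L1.trans L2).trans b.repr.symm.toContinuousLinearEquiv, ?_, ?_, ?_⟩
  · have m1 : MeasurePreserving L1 volume volume := by
      have := (volume_preserving_piFinSuccAbove (fun _ : Fin (m + 1) => ℝ) 0).symm
      convert! this using 1
      ext z : 1
      have := Fin.insertNth_zero (α := fun _ : Fin (m + 1) => ℝ) z.1 z.2
      exact this.symm
    have m2 : MeasurePreserving L2 volume volume :=
      (EuclideanSpace.volume_preserving_symm_measurableEquiv_toLp (Fin (m + 1))).symm
    have m3 := b.repr.symm.measurePreserving
    exact m3.comp (m2.comp m1)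
  · intro z
    rw [← hb0, ← b.repr_apply_apply, hΘ]
    simp
  · intro z i
    have := hΘ z i.succ
    rw [← b.repr.norm_map]
    simp only [Fin.cons_succ] at this
    rw [← this, ← Real.norm_eq_abs]
    exact PiLp.norm_apply_le _ _

lemma PW.directional (m : ℕ) (K : Set (EuclideanSpace ℝ (Fin (m + 1)))) (hKo : IsOpen K)
    (hKc : Convex ℝ K) (hKb : Bornology.IsBounded K) (hKn : K.Nonempty)
    (e : EuclideanSpace ℝ (Fin (m + 1))) (he : ‖e‖ = 1) (d k : ℝ) (hd : Metric.diam K ≤ d)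
    (hk : 0 < k) (hkd : k * d < Real.pi) (g g1 : ℝ → ℝ) (hg : ∀ t, HasDerivAt g (g1 t) t)
    (hg1 : Continuous g1) :
    k ^ 2 * (volume.real K * (∫ x in K, g (inner ℝ e x) ^ 2) -
      (∫ x in K, g (inner ℝ e x)) ^ 2) ≤
      volume.real K * ∫ x in K, g1 (inner ℝ e x) ^ 2 := by
  have hgc : Continuous g := continuous_iff_continuousAt.2 fun t => (hg t).continuousAt
  obtain ⟨Θ, hΘm, hΘe, hΘn⟩ := PW.exists_coords m e he
  have hΘemb : MeasurableEmbedding Θ := Θ.toHomeomorph.measurableEmbedding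
  set K' : Set (ℝ × (Fin m → ℝ)) := Θ ⁻¹' K with hK'
  have hK'o : IsOpen K' := hKo.preimage Θ.continuous
  have hK'c : Convex ℝ K' := hKc.linear_preimage Θ.toLinearEquiv.toLinearMap
  set p : ℝ → ℝ := fun t => volume.real (Prod.mk t ⁻¹' K') with hp
  obtain ⟨R, hR⟩ := hKb.exists_norm_le
  have hsec_o : ∀ t, IsOpen (Prod.mk t ⁻¹' K') := fun t => hK'o.preimage (by fun_prop)
  have hsec_sub : ∀ t, Prod.mk t ⁻¹' K' ⊆ Metric.closedBall 0 (max R 0) := by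
    intro t y hy
    rw [mem_closedBall_zero_iff, pi_norm_le_iff_of_nonneg (le_max_right _ _)]
    intro i
    exact ((hΘn (t, y) i).trans (hR _ hy)).trans (le_max_left _ _)
  have hsec_fin : ∀ t, volume (Prod.mk t ⁻¹' K') ≠ ⊤ := fun t =>
    ((measure_mono (hsec_sub t)).trans_lt measure_closedBall_lt_top).ne
  -- the projection interval
  set I : Set ℝ := (fun x => inner ℝ e x) '' K with hI
  have hIK : ∀ t, t ∈ I ↔ (Prod.mk t ⁻¹' K').Nonempty := by
    intro t
    constructor
    · rintro ⟨x, hx, rfl⟩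
      refine ⟨(Θ.symm x).2, ?_⟩
      have : ((inner ℝ e x : ℝ), (Θ.symm x).2) = Θ.symm x := by
        ext1
        · have := hΘe (Θ.symm x)
          simpa using this
        · rfl
      change Θ ((inner ℝ e x : ℝ), (Θ.symm x).2) ∈ K
      rw [this]; simpa using hx
    · rintro ⟨y, hy⟩
      exact ⟨Θ (t, y), hy, hΘe _⟩
  have hIfst : I = Prod.fst '' K' := by
    ext t
    rw [hIK]
    constructor
    · rintro ⟨y, hy⟩; exact ⟨(t, y), hy, rfl⟩
    · rintro ⟨⟨t', y⟩, hy, rfl⟩; exact ⟨y, hy⟩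
  have hIo : IsOpen I := by rw [hIfst]; exact isOpenMap_fst _ hK'o
  have hIc : Convex ℝ I := by
    rw [hIfst]; exact hK'c.linear_image (LinearMap.fst ℝ ℝ (Fin m → ℝ))
  have hIn : I.Nonempty := hKn.image _
  have hIdiff : ∀ s ∈ I, ∀ t ∈ I, t ≤ s + d := by
    rintro _ ⟨x, hx, rfl⟩ _ ⟨y, hy, rfl⟩
    have h1 : (inner ℝ e y : ℝ) - inner ℝ e x = inner ℝ e (y - x) := (inner_sub_right _ _ _).symm
    have h2 := real_inner_le_norm e (y - x)
    have h3 := Metric.dist_le_diam_of_mem hKb hy hx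
    rw [dist_eq_norm] at h3
    rw [he, one_mul] at h2
    simp only
    linarith
  have hIa : BddAbove I := by
    obtain ⟨s, hs⟩ := hIn
    exact ⟨s + d, fun t ht => hIdiff s hs t ht⟩
  have hIb : BddBelow I := by
    obtain ⟨s, hs⟩ := hIn
    exact ⟨s - d, fun t ht => by linarith [hIdiff t ht s hs]⟩
  set a := sInf I with ha
  set b := sSup I with hb
  have hIab : I = Set.Ioo a b := by
    apply Set.Subset.antisymm
    · rw [← interior_Icc]
      exact interior_maximal (subset_Icc_csInf_csSup hIb hIa) hIo
    · exact IsConnected.Ioo_csInf_csSup_subset (hIc.isConnected hIn) hIb hIa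
  have hab : a < b := by
    obtain ⟨s, hs⟩ := hIn
    rw [hIab] at hs
    exact hs.1.trans hs.2
  have hbad : b - a ≤ d := by
    have : b - d ≤ a := le_csInf hIn fun s hs => by
      have : b ≤ s + d := csSup_le hIn fun t ht => hIdiff s hs t ht
      linarith
    linarith
  have hp_pos : ∀ t ∈ Set.Ioo a b, 0 < p t := by
    intro t ht
    rw [← hIab, hIK] at ht
    exact ENNReal.toReal_pos ((hsec_o t).measure_pos volume ht).ne' (hsec_fin t)
  have hp_zero : ∀ t ∉ Set.Ioo a b, p t = 0 := by
    intro t ht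
    rw [← hIab, hIK, Set.not_nonempty_iff_eq_empty] at ht
    simp [hp, ht]
  -- Fubini
  have hIntg : ∀ q : ℝ → ℝ, Continuous q → IntegrableOn (fun z : ℝ × (Fin m → ℝ) => q z.1) K' := by
    intro q hq
    have h1 : IntegrableOn (fun x => q (inner ℝ e x)) K := by
      have hc : Continuous fun x : EuclideanSpace ℝ (Fin (m + 1)) => q (inner ℝ e x) := by fun_prop
      exact (hc.continuousOn.integrableOn_compact hKb.isCompact_closure).mono_set subset_closure
    have := (hΘm.integrableOn_comp_preimage hΘemb).2 h1
    refine this.congr_fun ?_ hK'o.measurableSet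
    intro z _
    simp [hΘe]
  have hfub0 : ∀ q : ℝ → ℝ, ∀ t, ∫ y, K'.indicator (fun z : ℝ × (Fin m → ℝ) => q z.1) (t, y)
      = q t * p t := by
    intro q t
    have : (fun y => K'.indicator (fun z : ℝ × (Fin m → ℝ) => q z.1) (t, y)) =
        (Prod.mk t ⁻¹' K').indicator (fun _ => q t) := by
      ext y; rfl
    rw [this, integral_indicator (hsec_o t).measurableSet, setIntegral_const, smul_eq_mul, mul_comm]
  have hfub : ∀ q : ℝ → ℝ, Continuous q →
      ∫ x in K, q (inner ℝ e x) = ∫ t in Set.Ioo a b, q t * p t := by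
    intro q hq
    rw [← hΘm.setIntegral_preimage_emb hΘemb, ← integral_indicator hK'o.measurableSet]
    simp only [hΘe]
    rw [Measure.volume_eq_prod, integral_prod]
    · simp only [hfub0]
      rw [setIntegral_eq_integral_of_forall_compl_eq_zero]
      intro t ht
      rw [hp_zero t ht, mul_zero]
    · rw [← Measure.volume_eq_prod]
      exact (integrable_indicator_iff hK'o.measurableSet).2 (hIntg q hq)
  have hpi : IntegrableOn p (Set.Ioo a b) := by
    have h1 : Integrable (K'.indicator (fun z : ℝ × (Fin m → ℝ) => (1:ℝ)))
        ((volume : Measure ℝ).prod (volume : Measure (Fin m → ℝ))) := by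
      rw [← Measure.volume_eq_prod]
      exact (integrable_indicator_iff hK'o.measurableSet).2 (hIntg (fun _ => 1) continuous_const)
    have h2 := h1.integral_prod_left
    have h3 := hfub0 (fun _ => 1)
    simp only [h3, one_mul] at h2
    exact h2.integrableOn
  have hconv : ConvexOn ℝ (Set.Ioo a b) (fun t => -Real.log (p t)) := by
    rw [convexOn_iff_forall_pos]
    refine ⟨convex_Ioo _ _, ?_⟩
    intro t ht t' ht' α β hα hβ hαβ
    have hmid : α * t + β * t' ∈ Set.Ioo a b := convex_Ioo a b ht ht' hα.le hβ.le hαβ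
    have key := PW.marginal α β hα hβ hαβ R m
      (fun x y => K'.indicator (fun _ => 1) (x, y)) 1
      (measurable_const.indicator hK'o.measurableSet) ENNReal.one_ne_top
      (fun x y => Set.indicator_apply_le' (fun _ => le_rfl) (fun _ => zero_le)) ?_ ?_ t t'
    · have e0 : ∀ t, ∫⁻ y, K'.indicator (fun _ => (1 : ENNReal)) (t, y) =
          volume (Prod.mk t ⁻¹' K') := by
        intro t
        have : (fun y => K'.indicator (fun _ => (1 : ENNReal)) (t, y)) =
          (Prod.mk t ⁻¹' K').indicator (fun _ => 1) := by
          ext y; rfl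
        rw [this, lintegral_indicator (hsec_o t).measurableSet]; simp
      simp only [e0] at key
      have k2 := ENNReal.toReal_mono (hsec_fin _) key
      rw [ENNReal.toReal_mul, ← ENNReal.toReal_rpow, ← ENNReal.toReal_rpow] at k2
      change p t ^ α * p t' ^ β ≤ p (α * t + β * t') at k2
      have h1 := hp_pos t ht
      have h2 := hp_pos t' ht'
      have k3 := Real.log_le_log (by positivity) k2
      rw [Real.log_mul (by positivity) (by positivity), Real.log_rpow h1, Real.log_rpow h2] at k3
      simp only [smul_eq_mul]
      linarith
    · intro x y i hi
      apply Set.indicator_of_notMem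
      intro hmem
      linarith [hΘn (x, y) i, hR _ hmem]
    · intro x x' y y'
      by_cases h1 : (x, y) ∈ K'
      · by_cases h2 : (x', y') ∈ K'
        · have h3 := hK'c h1 h2 hα.le hβ.le hαβ
          have h4 : (α * x + β * x', α • y + β • y') ∈ K' := h3
          simp [Set.indicator_of_mem h1, Set.indicator_of_mem h2, Set.indicator_of_mem h4]
        · simp [Set.indicator_of_notMem h2, ENNReal.zero_rpow_of_pos hβ]
      · simp [Set.indicator_of_notMem h1, ENNReal.zero_rpow_of_pos hα]
  have final := PW.oneD_logconcave p g g1 a b k hab hk (by nlinarith) hp_pos hconv hpi hg hg1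
  have f0 := hfub (fun _ => 1) continuous_const
  simp only [one_mul, setIntegral_const, smul_eq_mul, mul_one] at f0
  rw [f0, hfub g hgc, hfub (fun t => g t ^ 2) (by fun_prop), hfub (fun t => g1 t ^ 2) (by fun_prop)]
  exact final

lemma PW.hyperplane_null {n : ℕ} (i j : Fin n) (hij : i ≠ j) (c s a1 a2 : ℝ)
    (hcs : c ^ 2 + s ^ 2 = 1) :
    volume {x : EuclideanSpace ℝ (Fin n) | c * (x i - a1) + s * (x j - a2) = 0} = 0 := by
  set S := {x : EuclideanSpace ℝ (Fin n) | c * (x i - a1) + s * (x j - a2) = 0} with hS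
  rcases S.eq_empty_or_nonempty with h0 | ⟨x0, hx0⟩
  · simp [h0]
  let L : EuclideanSpace ℝ (Fin n) →ₗ[ℝ] ℝ :=
    { toFun := fun x => c * x i + s * x j
      map_add' := by intro x y; simp; ring
      map_smul' := by intro r x; simp; ring }
  have h1 : S ⊆ (AffineSubspace.mk' x0 (LinearMap.ker L) : Set (EuclideanSpace ℝ (Fin n))) := by
    intro x hx
    rw [SetLike.mem_coe, AffineSubspace.mem_mk', LinearMap.mem_ker]
    simp only [hS, Set.mem_ofPred_eq] at hx hx0
    simp only [L, vsub_eq_sub, LinearMap.coe_mk, AddHom.coe_mk, PiLp.sub_apply]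
    linarith
  refine measure_mono_null h1 (Measure.addHaar_affineSubspace _ _ ?_)
  intro htop
  have h2 : LinearMap.ker L = ⊤ := by
    rw [← AffineSubspace.direction_mk' x0 (LinearMap.ker L), htop, AffineSubspace.direction_top]
  have h3 : L (EuclideanSpace.single i c + EuclideanSpace.single j s) = 0 := by
    rw [← LinearMap.mem_ker, h2]; trivial
  simp [L, hij, hij.symm] at h3
  nlinarith

lemma PW.bisect_aux {n : ℕ} (K : Set (EuclideanSpace ℝ (Fin n))) (hKo : IsOpen K)
    (f : EuclideanSpace ℝ (Fin n) → ℝ) (hfK : IntegrableOn f K)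
    (h0 : ∫ x in K, f x = 0) (i j : Fin n) (hij : i ≠ j) (a1 a2 : ℝ) :
    ∃ c s : ℝ, c ^ 2 + s ^ 2 = 1 ∧
      ∫ x in K ∩ {x | 0 < c * (x i - a1) + s * (x j - a2)}, f x = 0 := by
  set H : ℝ → Set (EuclideanSpace ℝ (Fin n)) := fun θ =>
    {x | 0 < Real.cos θ * (x i - a1) + Real.sin θ * (x j - a2)} with hH
  have hHo : ∀ θ, IsOpen (H θ) := fun θ => isOpen_lt continuous_const (by fun_prop)
  set J : ℝ → ℝ := fun θ => ∫ x in K, (H θ).indicator f x with hJ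
  have hJe : ∀ θ, J θ = ∫ x in K ∩ H θ, f x := fun θ => by
    rw [hJ]; exact setIntegral_indicator (hHo θ).measurableSet
  have hnull : ∀ θ, ∀ᵐ x ∂(volume.restrict K),
      Real.cos θ * (x i - a1) + Real.sin θ * (x j - a2) ≠ 0 := by
    intro θ
    refine ae_restrict_of_ae ?_
    have := PW.hyperplane_null i j hij (Real.cos θ) (Real.sin θ) a1 a2 (Real.cos_sq_add_sin_sq θ)
    rw [ae_iff]
    simpa using this
  have hJc : Continuous J := by
    rw [continuous_iff_continuousAt]
    intro θ
    refine tendsto_integral_filter_of_dominated_convergence (fun x => ‖f x‖) ?_ ?_ hfK.norm ?_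
    · exact Filter.Eventually.of_forall fun θ =>
        hfK.aestronglyMeasurable.indicator (hHo θ).measurableSet
    · exact Filter.Eventually.of_forall fun θ => Filter.Eventually.of_forall fun x =>
        norm_indicator_le_norm_self _ _
    · filter_upwards [hnull θ] with x hx
      have hc : Continuous fun θ : ℝ => Real.cos θ * (x i - a1) + Real.sin θ * (x j - a2) := by
        fun_prop
      rcases lt_or_gt_of_ne hx with hlt | hgt
      · have := hc.continuousAt.eventually_lt (continuousAt_const (y := (0:ℝ))) hlt
        refine tendsto_nhds_of_eventually_eq ?_
        filter_upwards [this] with θ' hθ'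
        rw [Set.indicator_of_notMem, Set.indicator_of_notMem]
        · simp only [hH, Set.mem_ofPred_eq]; linarith
        · simp only [hH, Set.mem_ofPred_eq]; linarith
      · have := (continuousAt_const (y := (0:ℝ))).eventually_lt hc.continuousAt hgt
        refine tendsto_nhds_of_eventually_eq ?_
        filter_upwards [this] with θ' hθ'
        rw [Set.indicator_of_mem, Set.indicator_of_mem]
        · exact hgt
        · exact hθ'
  have hsum : J 0 + J Real.pi = 0 := by
    have hi : ∀ θ, IntegrableOn ((H θ).indicator f) K := fun θ => hfK.indicator (hHo θ).measurableSet
    rw [hJ]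
    simp only
    rw [← integral_add (hi 0) (hi Real.pi)]
    refine Eq.trans ?_ h0
    apply integral_congr_ae
    filter_upwards [hnull 0] with x hx
    simp only [Real.cos_zero, Real.sin_zero, zero_mul, add_zero, one_mul] at hx
    rcases lt_or_gt_of_ne hx with hlt | hgt
    · rw [Set.indicator_of_notMem, Set.indicator_of_mem, zero_add]
      · simp [hH]; linarith
      · simp [hH]; linarith
    · rw [Set.indicator_of_mem, Set.indicator_of_notMem, add_zero]
      · simp [hH]; linarith
      · simp [hH]; linarith
  have hz : ∃ θ, J θ = 0 := by
    rcases le_total (J 0) 0 with hle | hle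
    · exact intermediate_value_univ₂ (a := 0) (b := Real.pi) hJc continuous_const hle
        (by linarith)
    · exact intermediate_value_univ₂ (a := Real.pi) (b := 0) hJc continuous_const (by linarith)
        hle
  obtain ⟨θ, hθ⟩ := hz
  exact ⟨Real.cos θ, Real.sin θ, Real.cos_sq_add_sin_sq θ, by rw [← hJe]; exact hθ⟩

lemma PW.bisect {n : ℕ} (K : Set (EuclideanSpace ℝ (Fin n))) (hKo : IsOpen K)
    (hKc : Convex ℝ K) (f Φ : EuclideanSpace ℝ (Fin n) → ℝ) (hfK : IntegrableOn f K)
    (hΦK : IntegrableOn Φ K)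
    (h0 : ∫ x in K, f x = 0) (h1 : ∫ x in K, Φ x < 0) (i j : Fin n) (a1 a2 : ℝ) :
    ∃ K' : Set (EuclideanSpace ℝ (Fin n)), K' ⊆ K ∧ IsOpen K' ∧ Convex ℝ K' ∧
      ∫ x in K', f x = 0 ∧ ∫ x in K', Φ x < 0 ∧
      (i ≠ j → ∃ c s : ℝ, c ^ 2 + s ^ 2 = 1 ∧
        ∀ x ∈ K', 0 ≤ c * (x i - a1) + s * (x j - a2)) := by
  by_cases hij : i = j
  · exact ⟨K, subset_rfl, hKo, hKc, h0, h1, fun h => absurd hij h⟩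
  obtain ⟨c, s, hcs, hz⟩ := PW.bisect_aux K hKo f hfK h0 i j hij a1 a2
  have hopen : ∀ c s : ℝ, IsOpen {x : EuclideanSpace ℝ (Fin n) |
      0 < c * (x i - a1) + s * (x j - a2)} :=
    fun c s => isOpen_lt continuous_const (by fun_prop)
  have hconv : ∀ c s : ℝ, Convex ℝ {x : EuclideanSpace ℝ (Fin n) |
      0 < c * (x i - a1) + s * (x j - a2)} := by
    intro c s x hx y hy α β hα hβ hαβ
    simp only [Set.mem_ofPred_eq, PiLp.add_apply, PiLp.smul_apply, smul_eq_mul] at *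
    have e : c * (α * x i + β * y i - a1) + s * (α * x j + β * y j - a2) =
        α * (c * (x i - a1) + s * (x j - a2)) + β * (c * (y i - a1) + s * (y j - a2))
        + (α + β - 1) * (c * a1 + s * a2) := by ring
    rw [e, hαβ]
    rcases hα.eq_or_lt with rfl | hα'
    · have : β = 1 := by linarith
      subst this; linarith
    · have := mul_pos hα' hx
      have := mul_nonneg hβ hy.le
      linarith
  have hsplit : ∀ φ : EuclideanSpace ℝ (Fin n) → ℝ, IntegrableOn φ K →
      ∫ x in K, φ x = (∫ x in K ∩ {x | 0 < c * (x i - a1) + s * (x j - a2)}, φ x) +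
        ∫ x in K ∩ {x | 0 < (-c) * (x i - a1) + (-s) * (x j - a2)}, φ x := by
    intro φ hφ
    rw [← setIntegral_union _ (hKo.inter (hopen _ _)).measurableSet
      (hφ.mono_set Set.inter_subset_left) (hφ.mono_set Set.inter_subset_left)]
    · apply setIntegral_congr_set
      rw [← Set.inter_union_distrib_left]
      have hn := PW.hyperplane_null i j hij c s a1 a2 hcs
      have hae : ∀ᵐ x : EuclideanSpace ℝ (Fin n), c * (x i - a1) + s * (x j - a2) ≠ 0 := by
        rw [ae_iff]; simpa using hn
      filter_upwards [hae] with x hx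
      refine propext ⟨fun h => ⟨h, ?_⟩, fun h => h.1⟩
      rcases lt_or_gt_of_ne hx with h | h
      · right
        rw [Set.mem_ofPred_eq]
        linarith
      · left; rw [Set.mem_ofPred_eq]; exact h
    · rw [Set.disjoint_left]
      rintro x ⟨-, hx⟩ ⟨-, hx'⟩
      simp only [Set.mem_ofPred_eq] at hx hx'
      linarith
  have hf2 := hsplit f hfK
  have hΦ2 := hsplit Φ hΦK
  rw [h0, hz, zero_add] at hf2
  by_cases hneg : ∫ x in K ∩ {x | 0 < c * (x i - a1) + s * (x j - a2)}, Φ x < 0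
  · exact ⟨_, Set.inter_subset_left, hKo.inter (hopen c s), hKc.inter (hconv c s), hz, hneg,
      fun _ => ⟨c, s, hcs, fun x hx => le_of_lt hx.2⟩⟩
  · exact ⟨_, Set.inter_subset_left, hKo.inter (hopen (-c) (-s)), hKc.inter (hconv (-c) (-s)),
      hf2.symm, by linarith, fun _ => ⟨-c, -s, by linarith, fun x hx => le_of_lt hx.2⟩⟩

lemma PW.rational_point (x1 x2 u1 u2 v1 v2 : ℝ) (hD : u1 * v2 - u2 * v1 ≠ 0) :
    ∃ q1 q2 : ℚ, ∃ s t : ℝ, 0 < s ∧ 0 < t ∧ s + t < 1 ∧ (q1 : ℝ) = x1 + s * u1 + t * v1 ∧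
      (q2 : ℝ) = x2 + s * u2 + t * v2 := by
  set D := u1 * v2 - u2 * v1 with hDd
  let S : ℝ × ℝ → ℝ := fun q => ((q.1 - x1) * v2 - (q.2 - x2) * v1) / D
  let T : ℝ × ℝ → ℝ := fun q => (u1 * (q.2 - x2) - u2 * (q.1 - x1)) / D
  have hS : Continuous S := by fun_prop
  have hT : Continuous T := by fun_prop
  have ho : IsOpen {q : ℝ × ℝ | 0 < S q ∧ 0 < T q ∧ S q + T q < 1} :=
    (isOpen_lt continuous_const hS).inter ((isOpen_lt continuous_const hT).inter
      (isOpen_lt (hS.add hT) continuous_const))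
  have hd : DenseRange (Prod.map ((↑) : ℚ → ℝ) ((↑) : ℚ → ℝ)) :=
    Rat.denseRange_cast.prodMap Rat.denseRange_cast
  obtain ⟨⟨q1, q2⟩, hq⟩ := hd.exists_mem_open ho
    ⟨(x1 + (u1 + v1) / 3, x2 + (u2 + v2) / 3), by
      have e1 : S (x1 + (u1 + v1) / 3, x2 + (u2 + v2) / 3) = 1 / 3 := by
        simp only [S]; rw [div_eq_iff hD]; ring
      have e2 : T (x1 + (u1 + v1) / 3, x2 + (u2 + v2) / 3) = 1 / 3 := by
        simp only [T]; rw [div_eq_iff hD]; ring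
      simp only [Set.mem_ofPred_eq, e1, e2]
      norm_num⟩
  refine ⟨q1, q2, S (q1, q2), T (q1, q2), hq.1, hq.2.1, hq.2.2, ?_, ?_⟩
  · simp only [S, T]; field_simp; rw [hDd]; ring
  · simp only [S, T]; field_simp; rw [hDd]; ring

lemma PW.minor_zero {n : ℕ} (S : Set (EuclideanSpace ℝ (Fin n)))
    (hS : ∀ (i j : Fin n) (q1 q2 : ℚ), i ≠ j → ∃ c s : ℝ, c ^ 2 + s ^ 2 = 1 ∧
        ∀ x ∈ S, 0 ≤ c * (x i - q1) + s * (x j - q2))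
    (x y z : EuclideanSpace ℝ (Fin n)) (hx : x ∈ S) (hy : y ∈ S) (hz : z ∈ S) (i j : Fin n) :
    (y - x) i * (z - x) j = (y - x) j * (z - x) i := by
  by_cases hij : i = j
  · subst hij; ring
  by_contra hne
  obtain ⟨q1, q2, s, t, hs, ht, hst, e1, e2⟩ := PW.rational_point (x i) (x j) ((y - x) i)
    ((y - x) j) ((z - x) i) ((z - x) j) (sub_ne_zero.2 hne)
  obtain ⟨c, r, hcr, H⟩ := hS i j q1 q2 hij
  have Hx := H x hx
  have Hy := H y hy
  have Hz := H z hz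
  rw [e1, e2] at Hx Hy Hz
  simp only [PiLp.sub_apply] at *
  set u1 := y i - x i with hu1
  set u2 := y j - x j with hu2
  set v1 := z i - x i with hv1
  set v2 := z j - x j with hv2
  rw [show y i = x i + u1 by rw [hu1]; ring, show y j = x j + u2 by rw [hu2]; ring] at Hy
  rw [show z i = x i + v1 by rw [hv1]; ring, show z j = x j + v2 by rw [hv2]; ring] at Hz
  set A := c * u1 + r * u2 with hA
  set B := c * v1 + r * v2 with hB
  have Hx' : s * A + t * B ≤ 0 := by rw [hA, hB]; linarith
  have Hy' : s * A + t * B ≤ A := by rw [hA, hB]; linarith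
  have Hz' : s * A + t * B ≤ B := by rw [hA, hB]; linarith
  have hw : 0 ≤ (1 - s - t) * (-(s * A + t * B)) := mul_nonneg (by linarith) (by linarith)
  have hw2 : 0 ≤ s * (A - (s * A + t * B)) := mul_nonneg hs.le (by linarith)
  have hw3 : 0 ≤ t * (B - (s * A + t * B)) := mul_nonneg ht.le (by linarith)
  have hsum : (1 - s - t) * (-(s * A + t * B)) + s * (A - (s * A + t * B))
    + t * (B - (s * A + t * B)) = 0 := by ring
  have z0 : s * A + t * B = 0 := by
    have h := (mul_eq_zero.1 (by linarith : (1 - s - t) * (-(s * A + t * B)) = 0)).resolve_left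
      (by linarith)
    linarith
  have z1 : A = 0 := by
    have h := (mul_eq_zero.1 (by linarith : s * (A - (s * A + t * B)) = 0)).resolve_left hs.ne'
    linarith
  have z2 : B = 0 := by
    have h := (mul_eq_zero.1 (by linarith : t * (B - (s * A + t * B)) = 0)).resolve_left ht.ne'
    linarith
  have hD : u1 * v2 - u2 * v1 ≠ 0 := sub_ne_zero.2 hne
  have c0 : c = 0 := by
    have : c * (u1 * v2 - u2 * v1) = 0 := by
      have : c * (u1 * v2 - u2 * v1) = A * v2 - B * u2 := by rw [hA, hB]; ring
      rw [this, z1, z2]; ring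
    exact (mul_eq_zero.1 this).resolve_right hD
  have r0 : r = 0 := by
    have : r * (u1 * v2 - u2 * v1) = 0 := by
      have : r * (u1 * v2 - u2 * v1) = B * u1 - A * v1 := by rw [hA, hB]; ring
      rw [this, z1, z2]; ring
    exact (mul_eq_zero.1 this).resolve_right hD
  rw [c0, r0] at hcr
  norm_num at hcr

lemma PW.on_line {m : ℕ} (S : Set (EuclideanSpace ℝ (Fin (m + 1)))) (hSn : S.Nonempty)
    (hS : ∀ x ∈ S, ∀ y ∈ S, ∀ z ∈ S, ∀ i j : Fin (m + 1),
      (y - x) i * (z - x) j = (y - x) j * (z - x) i) :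
    ∃ x0 e : EuclideanSpace ℝ (Fin (m + 1)), ‖e‖ = 1 ∧
      ∀ z ∈ S, z = x0 + (inner ℝ e z - inner ℝ e x0 : ℝ) • e := by
  obtain ⟨x0, hx0⟩ := hSn
  by_cases hne : ∃ y ∈ S, y ≠ x0
  · obtain ⟨y, hy, hyx⟩ := hne
    have hn : ‖y - x0‖ ≠ 0 := norm_ne_zero_iff.2 (sub_ne_zero.2 hyx)
    refine ⟨x0, ‖y - x0‖⁻¹ • (y - x0), ?_, ?_⟩
    · rw [norm_smul, norm_inv, norm_norm, inv_mul_cancel₀ hn]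
    · intro z hz
      have key : (‖y - x0‖ ^ 2) • (z - x0) = (inner ℝ (y - x0) (z - x0) : ℝ) • (y - x0) := by
        ext j
        rw [PiLp.smul_apply, PiLp.smul_apply, EuclideanSpace.real_norm_sq_eq, PiLp.inner_apply,
          smul_eq_mul, smul_eq_mul, Finset.sum_mul, Finset.sum_mul]
        apply Finset.sum_congr rfl
        intro i _
        have := hS x0 hx0 y hy z hz i j
        simp only [RCLike.inner_apply, conj_trivial]
        linear_combination ((y - x0) i) * this
      have h2 : z - x0 = (‖y - x0‖⁻¹ * ‖y - x0‖⁻¹ * inner ℝ (y - x0) (z - x0)) • (y - x0) := by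
        have := congrArg (fun w => (‖y - x0‖⁻¹ * ‖y - x0‖⁻¹) • w) key
        simp only [smul_smul] at this
        rw [show ‖y - x0‖⁻¹ * ‖y - x0‖⁻¹ * ‖y - x0‖ ^ 2 = 1 by field_simp, one_smul] at this
        exact this
      rw [← inner_sub_right, inner_smul_left, smul_smul]
      simp only [conj_trivial]
      rw [show ‖y - x0‖⁻¹ * inner ℝ (y - x0) (z - x0) * ‖y - x0‖⁻¹ =
        ‖y - x0‖⁻¹ * ‖y - x0‖⁻¹ * inner ℝ (y - x0) (z - x0) by ring, ← h2]
      abel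
  · push Not at hne
    refine ⟨x0, EuclideanSpace.single 0 1, by simp, ?_⟩
    intro z hz
    rw [hne z hz]; simp

/-- Localization: a nested sequence of convex sets shrinking to a subset of a line. -/
lemma PW.localize {m : ℕ} (Ω : Set (EuclideanSpace ℝ (Fin (m + 1)))) (hΩo : IsOpen Ω)
    (hΩc : Convex ℝ Ω) (hΩb : Bornology.IsBounded Ω)
    (f Φ : EuclideanSpace ℝ (Fin (m + 1)) → ℝ) (hf : Continuous f) (hΦ : Continuous Φ)
    (h0 : ∫ x in Ω, f x = 0) (h1 : ∫ x in Ω, Φ x < 0) :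
    ∃ x0 e : EuclideanSpace ℝ (Fin (m + 1)), ‖e‖ = 1 ∧
      ∀ U : Set (EuclideanSpace ℝ (Fin (m + 1))), IsOpen U → (∀ t : ℝ, x0 + t • e ∈ U) →
      ∃ K ⊆ Ω, K ⊆ U ∧ IsOpen K ∧ Convex ℝ K ∧ ∫ x in K, f x = 0 ∧ ∫ x in K, Φ x < 0 := by
  let St := {K : Set (EuclideanSpace ℝ (Fin (m + 1))) // K ⊆ Ω ∧ IsOpen K ∧ Convex ℝ K ∧
    ∫ x in K, f x = 0 ∧ ∫ x in K, Φ x < 0}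
  let Tp := Fin (m + 1) × Fin (m + 1) × ℚ × ℚ
  have hstep : ∀ (K : St) (τ : Tp), ∃ K' : St, K'.1 ⊆ K.1 ∧ (τ.1 ≠ τ.2.1 →
      ∃ c s : ℝ, c ^ 2 + s ^ 2 = 1 ∧
        ∀ x ∈ K'.1, 0 ≤ c * (x τ.1 - τ.2.2.1) + s * (x τ.2.1 - τ.2.2.2)) := by
    rintro ⟨K, hKΩ, hKo, hKc, hK0, hK1⟩ τ
    have hi : ∀ φ : EuclideanSpace ℝ (Fin (m + 1)) → ℝ, Continuous φ → IntegrableOn φ K :=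
      fun φ hφ => (hφ.continuousOn.integrableOn_compact hΩb.isCompact_closure).mono_set
        (hKΩ.trans subset_closure)
    obtain ⟨K', hs, ho, hc, h0', h1', h2'⟩ := PW.bisect K hKo hKc f Φ (hi f hf) (hi Φ hΦ) hK0 hK1
      τ.1 τ.2.1 τ.2.2.1 τ.2.2.2
    exact ⟨⟨K', hs.trans hKΩ, ho, hc, h0', h1'⟩, hs, h2'⟩
  choose step hstep1 hstep2 using hstep
  obtain ⟨enum, henum⟩ := exists_surjective_nat Tp
  let seq : ℕ → St := fun k => Nat.rec ⟨Ω, subset_rfl, hΩo, hΩc, h0, h1⟩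
    (fun k K => step K (enum k)) k
  have hseq : ∀ k, seq (k + 1) = step (seq k) (enum k) := fun k => rfl
  have hanti : Antitone fun k => (seq k).1 := antitone_nat_of_succ_le fun k => by
    rw [hseq]; exact hstep1 _ _
  have hne : ∀ k, (seq k).1.Nonempty := by
    intro k
    by_contra hemp
    rw [Set.not_nonempty_iff_eq_empty] at hemp
    have := (seq k).2.2.2.2.2
    rw [hemp] at this
    simp at this
  have hcpt : ∀ k, IsCompact (closure (seq k).1) := fun k =>
    (hΩb.subset (seq k).2.1).isCompact_closure
  set S := ⋂ k, closure (seq k).1 with hSdef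
  have hSn : S.Nonempty := by
    apply IsCompact.nonempty_iInter_of_sequence_nonempty_isCompact_isClosed
    · intro k; exact closure_mono (hanti (Nat.le_succ k))
    · intro k; exact (hne k).closure
    · exact hcpt 0
    · intro k; exact isClosed_closure
  have hS : ∀ (i j : Fin (m + 1)) (q1 q2 : ℚ), i ≠ j → ∃ c s : ℝ, c ^ 2 + s ^ 2 = 1 ∧
        ∀ x ∈ S, 0 ≤ c * (x i - q1) + s * (x j - q2) := by
    intro i j q1 q2 hij
    obtain ⟨k, hk⟩ := henum (i, j, q1, q2)
    obtain ⟨c, s, hcs, hx⟩ := hstep2 (seq k) (enum k) (by rw [hk]; exact hij)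
    rw [← hseq, hk] at hx
    refine ⟨c, s, hcs, fun x hxS => ?_⟩
    have hcl : IsClosed {x : EuclideanSpace ℝ (Fin (m + 1)) |
      0 ≤ c * (x i - q1) + s * (x j - q2)} := isClosed_le continuous_const (by fun_prop)
    exact closure_minimal (s := (seq (k + 1)).1) hx hcl (Set.mem_iInter.1 hxS (k + 1))
  obtain ⟨x0, e, he, hline⟩ := PW.on_line S hSn fun x hx y hy z hz i j =>
    PW.minor_zero S hS x y z hx hy hz i j
  refine ⟨x0, e, he, fun U hUo hU => ?_⟩
  obtain ⟨k, hk⟩ := exists_subset_nhds_of_isCompact (V := fun k => closure (seq k).1) (U := U)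
    (by
      apply directed_of_isDirected_le
      intro a b hab
      exact closure_mono (hanti hab)) hcpt (by
      intro x hx
      apply hUo.mem_nhds
      rw [hline x hx]
      exact hU _)
  exact ⟨(seq k).1, (seq k).2.1, subset_closure.trans hk, (seq k).2.2⟩

lemma PW.poincare_k {m : ℕ} (Ω : Set (EuclideanSpace ℝ (Fin (m + 1)))) (hΩo : IsOpen Ω)
    (hΩc : Convex ℝ Ω) (hΩb : Bornology.IsBounded Ω)
    (f : EuclideanSpace ℝ (Fin (m + 1)) → ℝ) (hf : ContDiff ℝ (⊤ : ℕ∞) f)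
    (h0 : ∫ x in Ω, f x = 0) (k : ℝ) (hk : 0 < k) (hkd : k * Metric.diam Ω < Real.pi) :
    k ^ 2 * ∫ x in Ω, f x ^ 2 ≤ ∫ x in Ω, ‖fderiv ℝ f x‖ ^ 2 := by
  by_contra! hlt
  have hfc : Continuous f := hf.continuous
  have hf'c : Continuous (fderiv ℝ f) := hf.continuous_fderiv (by simp)
  have hIntg : ∀ K ⊆ Ω, ∀ φ : EuclideanSpace ℝ (Fin (m + 1)) → ℝ, Continuous φ →
      IntegrableOn φ K := fun K hK φ hφ =>
    (hφ.continuousOn.integrableOn_compact hΩb.isCompact_closure).mono_set (hK.trans subset_closure)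
  have hfin : ∀ K ⊆ Ω, volume K ≠ ⊤ := fun K hK => (hΩb.subset hK).measure_lt_top.ne
  set δ := k ^ 2 * (∫ x in Ω, f x ^ 2) - ∫ x in Ω, ‖fderiv ℝ f x‖ ^ 2 with hδ
  have hδp : 0 < δ := by linarith
  set η := δ / (2 * (volume.real Ω + 1)) with hη
  have hvol : 0 ≤ volume.real Ω := measureReal_nonneg
  have hηp : 0 < η := by positivity
  set Φ : EuclideanSpace ℝ (Fin (m + 1)) → ℝ :=
    fun x => ‖fderiv ℝ f x‖ ^ 2 - k ^ 2 * f x ^ 2 + η with hΦ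
  have hΦc : Continuous Φ := by fun_prop
  have hΦi : ∫ x in Ω, Φ x < 0 := by
    have e : ∫ x in Ω, Φ x = -δ + volume.real Ω * η := by
      rw [hΦ, integral_add (hIntg Ω subset_rfl _ (by fun_prop)) (hIntg Ω subset_rfl _ (by fun_prop)),
        integral_sub (hIntg Ω subset_rfl _ (by fun_prop)) (hIntg Ω subset_rfl _ (by fun_prop)),
        integral_const_mul, setIntegral_const, smul_eq_mul, hδ]
      ring
    rw [e]
    have : volume.real Ω * η ≤ δ / 2 := by
      rw [hη, ← mul_div_assoc, div_le_iff₀ (by positivity)]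
      nlinarith
    linarith
  obtain ⟨x0, e, he, hloc⟩ := PW.localize Ω hΩo hΩc hΩb f Φ hfc hΦc h0 hΦi
  -- restriction to the line
  set ρ : ℝ → EuclideanSpace ℝ (Fin (m + 1)) := fun t => x0 + (t - inner ℝ e x0) • e with hρ
  have hρc : Continuous ρ := by fun_prop
  set g : ℝ → ℝ := fun t => f (ρ t) with hg
  set g1 : ℝ → ℝ := fun t => fderiv ℝ f (ρ t) e with hg1
  have hgd : ∀ t, HasDerivAt g (g1 t) t := by
    intro t
    have h1 : HasDerivAt ρ e t := by
      have := (((hasDerivAt_id t).sub_const (inner ℝ e x0)).smul_const e).const_add x0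
      rw [one_smul] at this
      exact this
    exact ((hf.differentiable (by simp)) (ρ t)).hasFDerivAt.comp_hasDerivAt t h1
  have hgc : Continuous g := hfc.comp hρc
  have hg1c : Continuous g1 := by
    exact (hf'c.comp hρc).clm_apply continuous_const
  set τ := Real.sqrt (η / 2) / k with hτ
  have hτp : 0 < τ := by positivity
  have hτ2 : k ^ 2 * τ ^ 2 = η / 2 := by
    rw [hτ, div_pow, Real.sq_sqrt (by positivity)]; field_simp
  set U : Set (EuclideanSpace ℝ (Fin (m + 1))) :=
    {x | |f x - g (inner ℝ e x)| < τ} ∩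
    {x | g1 (inner ℝ e x) ^ 2 - k ^ 2 * g (inner ℝ e x) ^ 2 - η / 2 <
      ‖fderiv ℝ f x‖ ^ 2 - k ^ 2 * f x ^ 2} with hU
  have hUo : IsOpen U := (isOpen_lt (by fun_prop) continuous_const).inter
    (isOpen_lt (by fun_prop) (by fun_prop))
  have hUl : ∀ t : ℝ, x0 + t • e ∈ U := by
    intro t
    have hi : (inner ℝ e (x0 + t • e) : ℝ) = inner ℝ e x0 + t := by
      rw [inner_add_right, inner_smul_right, real_inner_self_eq_norm_sq, he]; ring
    have hr : ρ (inner ℝ e (x0 + t • e)) = x0 + t • e := by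
      rw [hi, hρ]; simp
    constructor
    · rw [Set.mem_ofPred_eq]
      simp only [hg, hr, sub_self, abs_zero]
      exact hτp
    · rw [Set.mem_ofPred_eq]
      simp only [hg, hg1, hr]
      have h1 := (fderiv ℝ f (x0 + t • e)).le_opNorm e
      rw [he, mul_one, Real.norm_eq_abs] at h1
      have h2 := pow_le_pow_left₀ (abs_nonneg _) h1 2
      rw [sq_abs] at h2
      linarith
  obtain ⟨K, hKΩ, hKU, hKo, hKc, hK0, hK1⟩ := hloc U hUo hUl
  have hKn : K.Nonempty := by
    by_contra hemp
    rw [Set.not_nonempty_iff_eq_empty] at hemp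
    rw [hemp] at hK1
    simp at hK1
  have hV : 0 < volume.real K :=
    ENNReal.toReal_pos (hKo.measure_pos volume hKn).ne' (hfin K hKΩ)
  have key := PW.directional m K hKo hKc (hΩb.subset hKΩ) hKn e he (Metric.diam Ω) k
    (Metric.diam_mono hKΩ hΩb) hk hkd g g1 hgd hg1c
  set V := volume.real K with hVdef
  set A := ∫ x in K, g (inner ℝ e x) ^ 2 with hA
  set B := ∫ x in K, g (inner ℝ e x) with hB
  set C := ∫ x in K, g1 (inner ℝ e x) ^ 2 with hC
  have hBb : |B| ≤ τ * V := by
    have e1 : B = ∫ x in K, (g (inner ℝ e x) - f x) := by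
      rw [integral_sub (hIntg K hKΩ _ (by fun_prop)) (hIntg K hKΩ _ (by fun_prop)), hK0, sub_zero]
    rw [e1, ← Real.norm_eq_abs]
    apply norm_setIntegral_le_of_norm_le_const (hfin K hKΩ).lt_top
    intro x hx
    have := (hKU hx).1
    rw [Set.mem_ofPred_eq] at this
    rw [Real.norm_eq_abs, abs_sub_comm]
    exact this.le
  have hlow : C - k ^ 2 * A + V * (η / 2) ≤ ∫ x in K, Φ x := by
    have e1 : C - k ^ 2 * A + V * (η / 2) =
        ∫ x in K, (g1 (inner ℝ e x) ^ 2 - k ^ 2 * g (inner ℝ e x) ^ 2 + η / 2) := by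
      rw [integral_add (hIntg K hKΩ _ (by fun_prop)) (hIntg K hKΩ _ (by fun_prop)),
        integral_sub (hIntg K hKΩ _ (by fun_prop)) (hIntg K hKΩ _ (by fun_prop)),
        integral_const_mul, setIntegral_const, smul_eq_mul]
    rw [e1]
    apply setIntegral_mono_on (hIntg K hKΩ _ (by fun_prop)) (hIntg K hKΩ _ hΦc) hKo.measurableSet
    intro x hx
    have := (hKU hx).2
    rw [Set.mem_ofPred_eq] at this
    simp only [hΦ]
    linarith
  have hBsq : B ^ 2 ≤ τ ^ 2 * V ^ 2 := by
    rw [← sq_abs, ← mul_pow]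
    exact pow_le_pow_left₀ (abs_nonneg _) hBb 2
  have h3 : 0 ≤ V * (C - k ^ 2 * A + V * (η / 2)) := by
    have : k ^ 2 * B ^ 2 ≤ (η / 2) * V ^ 2 := by
      rw [← hτ2, mul_assoc]
      exact mul_le_mul_of_nonneg_left hBsq (by positivity)
    nlinarith
  have h4 : V * (C - k ^ 2 * A + V * (η / 2)) < 0 := mul_neg_of_pos_of_neg hV (by linarith)
  linarith

lemma PW.intOn {n : ℕ} {Ω : Set (EuclideanSpace ℝ (Fin n))} (hΩb : Bornology.IsBounded Ω)
    {φ : EuclideanSpace ℝ (Fin n) → ℝ} (hφ : Continuous φ) : IntegrableOn φ Ω :=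
  (hφ.continuousOn.integrableOn_compact hΩb.isCompact_closure).mono_set subset_closure

lemma PW.sq_pos {n : ℕ} {Ω : Set (EuclideanSpace ℝ (Fin n))} (hΩo : IsOpen Ω)
    (hΩb : Bornology.IsBounded Ω)
    {φ : EuclideanSpace ℝ (Fin n) → ℝ} (hφ : Continuous φ) (h : ¬ ∀ x ∈ Ω, φ x = 0) :
    0 < ∫ x in Ω, φ x ^ 2 := by
  push Not at h
  obtain ⟨x, hx, hne⟩ := h
  rw [setIntegral_pos_iff_support_of_nonneg_ae (Filter.Eventually.of_forall
    (fun x => sq_nonneg (φ x))) (PW.intOn hΩb (hφ.pow 2))]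
  apply IsOpen.measure_pos
  · exact ((hφ.pow 2).isOpen_support).inter hΩo
  · exact ⟨x, by simpa using hne, hx⟩

lemma PW.poincare {m : ℕ} (Ω : Set (EuclideanSpace ℝ (Fin (m+1)))) (hΩo : IsOpen Ω)
    (hΩc : Convex ℝ Ω) (hΩb : Bornology.IsBounded Ω) (hd : 0 < Metric.diam Ω)
    (f : EuclideanSpace ℝ (Fin (m+1)) → ℝ)
    (hf : ContDiff ℝ (⊤ : ℕ∞) f) (h0 : ∫ x in Ω, f x = 0) :
    Real.pi ^ 2 / Metric.diam Ω ^ 2 * ∫ x in Ω, f x ^2 ≤ ∫ x in Ω, ‖fderiv ℝ f x‖^2 := by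
  have hlim : Filter.Tendsto (fun k : ℝ => k ^ 2 * ∫ x in Ω, f x ^ 2)
      (nhdsWithin (Real.pi / Metric.diam Ω) (Set.Iio (Real.pi / Metric.diam Ω)))
      (nhds ((Real.pi / Metric.diam Ω) ^ 2 * ∫ x in Ω, f x ^ 2)) := by
    apply Filter.Tendsto.mono_left _ nhdsWithin_le_nhds
    exact Continuous.tendsto (by fun_prop) _
  rw [← div_pow]
  refine le_of_tendsto hlim ?_
  have hpos : 0 < Real.pi / Metric.diam Ω := div_pos Real.pi_pos hd
  filter_upwards [Ioo_mem_nhdsLT hpos] with k hk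
  exact PW.poincare_k Ω hΩo hΩc hΩb f hf h0 k hk.1 ((lt_div_iff₀ hd).1 hk.2)

lemma PW.rayleigh_orth {n : ℕ} {Ω : Set (EuclideanSpace ℝ (Fin n))}
    (hΩb : Bornology.IsBounded Ω)
    {p q : EuclideanSpace ℝ (Fin n) → ℝ} (hp : ContDiff ℝ (⊤ : ℕ∞) p)
    (hq : ContDiff ℝ (⊤ : ℕ∞) q) (hA : 0 < ∫ x in Ω, p x ^ 2) (hB : 0 < ∫ x in Ω, q x ^ 2)
    (hpq : ∫ x in Ω, p x * q x = 0) :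
    ∃ C : ℝ, ∀ a b : ℝ, ∫ x in Ω, ‖fderiv ℝ (a • p + b • q) x‖ ^ 2 ≤
      C * ∫ x in Ω, (a • p + b • q) x ^ 2 := by
  have hpc := hp.continuous
  have hqc := hq.continuous
  have hp' : Continuous (fderiv ℝ p) := hp.continuous_fderiv (by simp)
  have hq' : Continuous (fderiv ℝ q) := hq.continuous_fderiv (by simp)
  set A := ∫ x in Ω, p x ^ 2 with hAd
  set B := ∫ x in Ω, q x ^ 2 with hBd
  set A' := ∫ x in Ω, ‖fderiv ℝ p x‖ ^ 2 with hA'd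
  set B' := ∫ x in Ω, ‖fderiv ℝ q x‖ ^ 2 with hB'd
  have hA' : 0 ≤ A' := integral_nonneg fun x => by positivity
  have hB' : 0 ≤ B' := integral_nonneg fun x => by positivity
  refine ⟨2 * (A' / A + B' / B), fun a b => ?_⟩
  have e1 : ∫ x in Ω, (a • p + b • q) x ^ 2 = a ^ 2 * A + b ^ 2 * B := by
    have i1 : IntegrableOn (fun x => a ^ 2 * p x ^ 2) Ω := PW.intOn hΩb (by fun_prop)
    have i2 : IntegrableOn (fun x => b ^ 2 * q x ^ 2) Ω := PW.intOn hΩb (by fun_prop)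
    have i3 : IntegrableOn (fun x => 2 * a * b * (p x * q x)) Ω := PW.intOn hΩb (by fun_prop)
    have : ∀ x, (a • p + b • q) x ^ 2 =
        a ^ 2 * p x ^ 2 + b ^ 2 * q x ^ 2 + 2 * a * b * (p x * q x) := by
      intro x
      simp only [Pi.add_apply, Pi.smul_apply, smul_eq_mul]
      ring
    simp_rw [this]
    have i12 : IntegrableOn (fun x => a ^ 2 * p x ^ 2 + b ^ 2 * q x ^ 2) Ω := i1.add i2
    rw [integral_add i12 i3, integral_add i1 i2, integral_const_mul, integral_const_mul,
      integral_const_mul, hpq]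
    ring
  have e2 : ∫ x in Ω, ‖fderiv ℝ (a • p + b • q) x‖ ^ 2 ≤ 2 * a ^ 2 * A' + 2 * b ^ 2 * B' := by
    have i1 : IntegrableOn (fun x => 2 * a ^ 2 * ‖fderiv ℝ p x‖ ^ 2) Ω :=
      PW.intOn hΩb (by fun_prop)
    have i2 : IntegrableOn (fun x => 2 * b ^ 2 * ‖fderiv ℝ q x‖ ^ 2) Ω :=
      PW.intOn hΩb (by fun_prop)
    rw [hA'd, hB'd, ← integral_const_mul, ← integral_const_mul, ← integral_add i1 i2]
    apply integral_mono_of_nonneg (Filter.Eventually.of_forall fun x => by positivity)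
      (i1.add i2) (Filter.Eventually.of_forall fun x => ?_)
    have dp : DifferentiableAt ℝ p x := (hp.differentiable (by simp)) x
    have dq : DifferentiableAt ℝ q x := (hq.differentiable (by simp)) x
    have e : fderiv ℝ (a • p + b • q) x = a • fderiv ℝ p x + b • fderiv ℝ q x :=
      ((dp.hasFDerivAt.const_smul a).add (dq.hasFDerivAt.const_smul b)).fderiv
    have hn : ‖fderiv ℝ (a • p + b • q) x‖ ≤
        |a| * ‖fderiv ℝ p x‖ + |b| * ‖fderiv ℝ q x‖ := by
      rw [e]
      refine (norm_add_le _ _).trans ?_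
      rw [norm_smul, norm_smul, Real.norm_eq_abs, Real.norm_eq_abs]
    have hn2 := pow_le_pow_left₀ (norm_nonneg _) hn 2
    change ‖fderiv ℝ (a • p + b • q) x‖ ^ 2 ≤
      2 * a ^ 2 * ‖fderiv ℝ p x‖ ^ 2 + 2 * b ^ 2 * ‖fderiv ℝ q x‖ ^ 2
    rw [← sq_abs a, ← sq_abs b]
    nlinarith [sq_nonneg (|a| * ‖fderiv ℝ p x‖ - |b| * ‖fderiv ℝ q x‖)]
  rw [e1]
  refine e2.trans ?_
  have f1 : A' = A' / A * A := by field_simp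
  have f2 : B' = B' / B * B := by field_simp
  have g1 : 0 ≤ A' / A := by positivity
  have g2 : 0 ≤ B' / B := by positivity
  have g3 : 0 ≤ A' / A * (b ^ 2 * B) := by positivity
  have g4 : 0 ≤ B' / B * (a ^ 2 * A) := by positivity
  calc 2 * a ^ 2 * A' + 2 * b ^ 2 * B'
      = 2 * a ^ 2 * (A' / A * A) + 2 * b ^ 2 * (B' / B * B) := by rw [← f1, ← f2]
    _ ≤ _ := by nlinarith

lemma PW.rayleigh_bdd {n : ℕ} {Ω : Set (EuclideanSpace ℝ (Fin n))} (hΩo : IsOpen Ω)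
    (hΩb : Bornology.IsBounded Ω)
    {p q : EuclideanSpace ℝ (Fin n) → ℝ} (hp : ContDiff ℝ (⊤ : ℕ∞) p)
    (hq : ContDiff ℝ (⊤ : ℕ∞) q)
    (hind : ∀ a b : ℝ, (∀ x ∈ Ω, (a • p + b • q) x = 0) → a = 0 ∧ b = 0) :
    ∃ C : ℝ, ∀ a b : ℝ, ∫ x in Ω, ‖fderiv ℝ (a • p + b • q) x‖ ^ 2 ≤
      C * ∫ x in Ω, (a • p + b • q) x ^ 2 := by
  have hpc := hp.continuous
  have hqc := hq.continuous
  have hA : 0 < ∫ x in Ω, p x ^ 2 := by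
    apply PW.sq_pos hΩo hΩb hpc
    intro h
    have := (hind 1 0 (fun x hx => by simp [h x hx])).1
    norm_num at this
  set c := (∫ x in Ω, p x * q x) / ∫ x in Ω, p x ^ 2 with hc
  set r : EuclideanSpace ℝ (Fin n) → ℝ := (-c) • p + (1 : ℝ) • q with hr
  have hrs : ContDiff ℝ (⊤ : ℕ∞) r := (hp.const_smul (-c)).add (hq.const_smul (1 : ℝ))
  have hB : 0 < ∫ x in Ω, r x ^ 2 := by
    apply PW.sq_pos hΩo hΩb hrs.continuous
    intro h
    have := (hind (-c) 1 h).2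
    norm_num at this
  have hpr : ∫ x in Ω, p x * r x = 0 := by
    have i1 : IntegrableOn (fun x => -c * p x ^ 2) Ω := PW.intOn hΩb (by fun_prop)
    have i2 : IntegrableOn (fun x => p x * q x) Ω := PW.intOn hΩb (by fun_prop)
    have : ∀ x, p x * r x = -c * p x ^ 2 + p x * q x := by
      intro x
      simp only [hr, Pi.add_apply, Pi.smul_apply, smul_eq_mul]
      ring
    simp_rw [this]
    rw [integral_add i1 i2, integral_const_mul, hc]
    field_simp
    ring
  obtain ⟨C, hC⟩ := PW.rayleigh_orth hΩb hp hrs hA hB hpr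
  refine ⟨C, fun a b => ?_⟩
  have := hC (a + b * c) b
  have e : (a + b * c) • p + b • r = a • p + b • q := by
    funext x
    simp only [hr, Pi.add_apply, Pi.smul_apply, smul_eq_mul]
    ring
  rwa [e] at this

lemma PW.rhs_nonneg {n : ℕ} (Ω : Set (EuclideanSpace ℝ (Fin n))) :
    0 ≤ neumannEigenvalue n 1 Ω := by
  unfold neumannEigenvalue
  refine Real.iInf_nonneg fun V => Real.iSup_nonneg fun f => ?_
  exact div_nonneg (integral_nonneg fun x => by positivity)
    (integral_nonneg fun x => by positivity)

lemma PW.family_nonempty {m : ℕ} (Ω : Set (EuclideanSpace ℝ (Fin (m + 1))))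
    (hΩo : IsOpen Ω) (hΩne : Ω.Nonempty) :
    Nonempty {V : Submodule ℝ (EuclideanSpace ℝ (Fin (m + 1)) → ℝ) //
      Module.finrank ℝ V = 1 + 1 ∧ (∀ f ∈ V, ContDiff ℝ (⊤ : ℕ∞) f) ∧
      ∀ f ∈ V, (∀ x ∈ Ω, f x = 0) → f = 0} := by
  set p : EuclideanSpace ℝ (Fin (m + 1)) → ℝ := fun _ => 1 with hp
  set q : EuclideanSpace ℝ (Fin (m + 1)) → ℝ := fun x => x 0 with hq
  have hps : ContDiff ℝ (⊤ : ℕ∞) p := contDiff_const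
  have hqs : ContDiff ℝ (⊤ : ℕ∞) q := by
    exact (EuclideanSpace.proj (𝕜 := ℝ) (0 : Fin (m + 1))).contDiff
  obtain ⟨x, hx⟩ := hΩne
  have hind : ∀ a b : ℝ, (∀ x ∈ Ω, (a • p + b • q) x = 0) → a = 0 ∧ b = 0 := by
    intro a b h
    set u : ℝ → EuclideanSpace ℝ (Fin (m + 1)) :=
      fun t => x + t • EuclideanSpace.single (0 : Fin (m + 1)) (1 : ℝ) with hu
    have huc : Continuous u := by fun_prop
    have hev : ∀ᶠ t in nhds (0 : ℝ), u t ∈ Ω := by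
      apply huc.continuousAt.eventually_mem
      apply hΩo.mem_nhds
      simpa [hu] using hx
    obtain ⟨ε, hε, hball⟩ := Metric.eventually_nhds_iff.1 hev
    have h1 := h x hx
    have h2 := h (u (ε / 2)) (hball (by
      rw [Real.dist_eq, sub_zero, abs_of_pos (by positivity)]; linarith))
    simp [hp, hq, hu] at h1 h2
    have hb : b = 0 := by
      have : b * (ε / 2) = 0 := by linarith
      rcases mul_eq_zero.1 this with h | h
      · exact h
      · linarith
    subst hb
    exact ⟨by linarith, rfl⟩
  have hmem : ∀ f ∈ Submodule.span ℝ (Set.range ![p, q]), ∃ a b : ℝ, f = a • p + b • q := by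
    intro f hf
    simp only [Matrix.range_cons, Matrix.range_empty, Set.union_empty] at hf
    rw [Set.singleton_union, Submodule.mem_span_pair] at hf
    obtain ⟨a, b, h⟩ := hf
    exact ⟨a, b, h.symm⟩
  refine ⟨⟨Submodule.span ℝ (Set.range ![p, q]), ?_, ?_, ?_⟩⟩
  · have hli : LinearIndependent ℝ ![p, q] := by
      rw [LinearIndependent.pair_iff]
      intro a b h
      exact hind a b (fun x _ => by rw [h]; rfl)
    rw [finrank_span_eq_card hli]
    simp
  · intro f hf
    obtain ⟨a, b, rfl⟩ := hmem f hf
    exact (hps.const_smul a).add (hqs.const_smul b)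
  · intro f hf h
    obtain ⟨a, b, rfl⟩ := hmem f hf
    obtain ⟨rfl, rfl⟩ := hind a b h
    simp

/-- The Payne–Weinberger inequality: for a bounded convex domain `Ω ⊆ ℝⁿ`,
the first nonzero Neumann eigenvalue satisfies `μ₁(Ω) ≥ π² / (Diam Ω)²`. -/
theorem payne_weinberger {n : ℕ} (Ω : Set (EuclideanSpace ℝ (Fin n)))
    (hΩo : IsOpen Ω) (hΩc : Convex ℝ Ω) (hΩb : Bornology.IsBounded Ω)
    (hΩne : Ω.Nonempty) :
    Real.pi ^ 2 / Metric.diam Ω ^ 2 ≤ neumannEigenvalue n 1 Ω := by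
  rcases (Metric.diam_nonneg (s := Ω)).eq_or_lt with hd | hd
  · rw [← hd]
    simpa using PW.rhs_nonneg Ω
  cases n with
  | zero =>
    rw [Metric.diam_subsingleton Set.subsingleton_of_subsingleton] at hd
    exact absurd hd (lt_irrefl _)
  | succ m =>
    unfold neumannEigenvalue
    have := PW.family_nonempty Ω hΩo hΩne
    refine le_ciInf fun V => ?_
    obtain ⟨V, hV2, hVs, hVz⟩ := V
    have hV2' : Module.finrank ℝ V = 2 := hV2
    have : Module.Finite ℝ V := Module.finite_of_finrank_pos (by omega)
    let bs : Module.Basis (Fin 2) ℝ V := Module.finBasisOfFinrankEq ℝ V hV2'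
    set p : EuclideanSpace ℝ (Fin (m + 1)) → ℝ := (bs 0).1 with hp
    set q : EuclideanSpace ℝ (Fin (m + 1)) → ℝ := (bs 1).1 with hq
    have hpV : p ∈ V := (bs 0).2
    have hqV : q ∈ V := (bs 1).2
    have hcV : ∀ a b : ℝ, a • p + b • q ∈ V := fun a b =>
      V.add_mem (V.smul_mem a hpV) (V.smul_mem b hqV)
    have hli : ∀ a b : ℝ, a • p + b • q = 0 → a = 0 ∧ b = 0 := by
      have h := bs.linearIndependent
      rw [Fintype.linearIndependent_iff] at h
      intro a b hab
      have := h ![a, b] (by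
        apply Subtype.ext
        simpa [Fin.sum_univ_two] using hab)
      exact ⟨this 0, this 1⟩
    have hrep : ∀ f ∈ V, ∃ a b : ℝ, f = a • p + b • q := by
      intro f hf
      have := bs.sum_repr ⟨f, hf⟩
      rw [Fin.sum_univ_two] at this
      exact ⟨bs.repr ⟨f, hf⟩ 0, bs.repr ⟨f, hf⟩ 1, (congrArg Subtype.val this).symm⟩
    have hpos : ∀ f ∈ V, f ≠ 0 → 0 < ∫ x in Ω, f x ^ 2 := fun f hf hne =>
      PW.sq_pos hΩo hΩb (hVs f hf).continuous (fun h => hne (hVz f hf h))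
    obtain ⟨C, hC⟩ := PW.rayleigh_bdd hΩo hΩb (hVs p hpV) (hVs q hqV)
      (fun a b h => hli a b (hVz _ (hcV a b) h))
    have hbdd : BddAbove (Set.range fun f : {f : EuclideanSpace ℝ (Fin (m + 1)) → ℝ //
        f ∈ V ∧ f ≠ 0} => (∫ x in Ω, ‖fderiv ℝ f.1 x‖ ^ 2) / ∫ x in Ω, (f.1 x) ^ 2) := by
      refine ⟨C, ?_⟩
      rintro _ ⟨⟨f, hf, hne⟩, rfl⟩
      change (∫ x in Ω, ‖fderiv ℝ f x‖ ^ 2) / ∫ x in Ω, (f x) ^ 2 ≤ C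
      rw [div_le_iff₀ (hpos f hf hne)]
      obtain ⟨a, b, rfl⟩ := hrep f hf
      exact hC a b
    -- a nonzero mean-zero function in V
    obtain ⟨f, hf, hne, h0⟩ : ∃ f ∈ V, f ≠ 0 ∧ ∫ x in Ω, f x = 0 := by
      have hIntg : ∀ a b : ℝ, ∫ x in Ω, (a • p + b • q) x =
          a * (∫ x in Ω, p x) + b * ∫ x in Ω, q x := by
        intro a b
        have i1 : IntegrableOn (fun x => a * p x) Ω :=
          PW.intOn hΩb ((hVs p hpV).continuous.const_mul a)
        have i2 : IntegrableOn (fun x => b * q x) Ω :=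
          PW.intOn hΩb ((hVs q hqV).continuous.const_mul b)
        simp only [Pi.add_apply, Pi.smul_apply, smul_eq_mul]
        rw [integral_add i1 i2, integral_const_mul, integral_const_mul]
      by_cases hP : ∫ x in Ω, p x = 0
      · refine ⟨p, hpV, fun h => ?_, hP⟩
        have := (hli 1 0 (by simp [h])).1
        norm_num at this
      · refine ⟨(∫ x in Ω, q x) • p + (-∫ x in Ω, p x) • q, hcV _ _, fun h => ?_, ?_⟩
        · exact hP (neg_eq_zero.1 (hli _ _ h).2)
        · rw [hIntg]; ring
    refine le_trans ?_ (le_ciSup hbdd ⟨f, hf, hne⟩)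
    change _ ≤ (∫ x in Ω, ‖fderiv ℝ f x‖ ^ 2) / ∫ x in Ω, (f x) ^ 2
    rw [le_div_iff₀ (hpos f hf hne)]
    exact PW.poincare Ω hΩo hΩc hΩb hd f (hVs f hf) h0
end

section
/- Let Ω be a bounded domain in ℝⁿ with Lipschitz boundary. Then for every natural number k ≥ 1, the k-th Neumann eigenvalue satisfies μ_k(Ω) ≤ (2π)² · ((n+2)/2)^(2/n) · (k / (ω_n · vol Ω))^(2/n), where ω_n is the volume of the unit ball in ℝⁿ. -/
open MeasureTheory

open scoped NNReal RealInnerProductSpace in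
/-- `Ω` has Lipschitz boundary: near each boundary point, after choosing a unit
direction `v`, `Ω` is the region below the graph of a Lipschitz function over the
hyperplane orthogonal to `v`. -/
def HasLipschitzBoundary {n : ℕ} (Ω : Set (EuclideanSpace ℝ (Fin n))) : Prop :=
  ∀ x ∈ frontier Ω, ∃ (U : Set (EuclideanSpace ℝ (Fin n)))
      (v : EuclideanSpace ℝ (Fin n)) (f : EuclideanSpace ℝ (Fin n) → ℝ) (L : ℝ≥0),
    IsOpen U ∧ x ∈ U ∧ ‖v‖ = 1 ∧ LipschitzWith L f ∧
    Ω ∩ U = {y ∈ U | ⟪y, v⟫ < f (y - ⟪y, v⟫ • v)}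


section planch
open scoped FourierTransform ENNReal ContDiff SchwartzMap

lemma kr_planch {n : ℕ} (f : EuclideanSpace ℝ (Fin n) → ℂ) (hf1 : Integrable f)
    (hf2 : MemLp f 2 volume) : eLpNorm (𝓕 f) 2 volume = eLpNorm f 2 volume := by
  set g : Lp ℂ 2 (volume : Measure (EuclideanSpace ℝ (Fin n))) := hf2.toLp f with hg
  have hcont : Continuous (𝓕 f) :=
    VectorFourier.fourierIntegral_continuous Real.continuous_fourierChar continuous_inner hf1
  have hae : ∀ᵐ x, 𝓕 f x = (𝓕 g : Lp ℂ 2 (volume : Measure (EuclideanSpace ℝ (Fin n)))) x := by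
    apply ae_eq_of_integral_contDiff_smul_eq
    · exact hcont.locallyIntegrable
    · exact (Lp.memLp _).locallyIntegrable (by norm_num)
    · intro φ φs φc
      have hg₁ : HasCompactSupport (Complex.ofRealCLM ∘ φ) := φc.comp_left rfl
      have hg₂ : ContDiff ℝ ∞ (Complex.ofRealCLM ∘ φ) := by fun_prop
      have h1 := congrArg (fun T => T (hg₁.toSchwartzMap hg₂))
        (MeasureTheory.Lp.fourier_toTemperedDistribution_eq g)
      simp only [TemperedDistribution.fourier_apply, Lp.toTemperedDistribution_apply] at h1
      have h2 : ∫ x, (𝓕 (hg₁.toSchwartzMap hg₂)) x • g x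
          = ∫ x, (𝓕 (hg₁.toSchwartzMap hg₂)) x • f x := by
        apply integral_congr_ae
        filter_upwards [hf2.coeFn_toLp] with x hx
        rw [hx]
      have h3 := VectorFourier.integral_fourierIntegral_smul_eq_flip (μ := volume) (ν := volume)
        (L := innerₗ (EuclideanSpace ℝ (Fin n)))
        (f := (hg₁.toSchwartzMap hg₂ : EuclideanSpace ℝ (Fin n) → ℂ)) (g := f)
        Real.continuous_fourierChar continuous_inner (SchwartzMap.integrable _) hf1
      rw [flip_innerₗ] at h3
      have h4 : ∫ x, φ x • 𝓕 f x = ∫ x, (hg₁.toSchwartzMap hg₂) x • 𝓕 f x := by simp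
      have h5 : ∫ x, φ x • (𝓕 g : Lp ℂ 2 (volume : Measure (EuclideanSpace ℝ (Fin n)))) x = ∫ x, (hg₁.toSchwartzMap hg₂) x • (𝓕 g : Lp ℂ 2 (volume : Measure (EuclideanSpace ℝ (Fin n)))) x := by simp
      rw [h4, h5, ← h1, h2]
      exact h3.symm
  rw [eLpNorm_congr_ae hae, ← ENNReal.toReal_eq_toReal_iff' (Lp.memLp _).2.ne hf2.2.ne, ← Lp.norm_def,
    Lp.norm_fourier_eq, hg, Lp.norm_toLp]
end planch

lemma kr_diag {W : Type*} [AddCommGroup W] [Module ℝ W] [FiniteDimensional ℝ W]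
    (a b : W →ₗ[ℝ] W →ₗ[ℝ] ℝ) (ha : ∀ x y, a x y = a y x) (hb : ∀ x y, b x y = b y x)
    (hb0 : ∀ x, 0 ≤ b x x) (hb1 : ∀ x, b x x = 0 → x = 0) :
    ∃ (e : Module.Basis (Fin (Module.finrank ℝ W)) ℝ W) (l : Fin (Module.finrank ℝ W) → ℝ),
      (∀ i j, b (e i) (e j) = if i = j then 1 else 0) ∧
      (∀ i j, a (e i) (e j) = if i = j then l i else 0) := by
  let c : InnerProductSpace.Core ℝ W :=
    { inner := fun x y => b x y
      conj_inner_symm := fun x y => by simp [hb x y]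
      re_inner_nonneg := fun x => by simpa using hb0 x
      add_left := fun x y z => by simp
      smul_left := fun x y r => by simp
      definite := hb1 }
  let : NormedAddCommGroup W := c.toNormedAddCommGroup
  let : InnerProductSpace ℝ W := InnerProductSpace.ofCore c.toCore
  have hin : ∀ x y : W, inner ℝ x y = b x y := fun x y => rfl
  let T : W →ₗ[ℝ] W := (InnerProductSpace.toDual ℝ W).symm.toLinearEquiv.toLinearMap ∘ₗ
    (LinearMap.toContinuousLinearMap.toLinearMap ∘ₗ a)
  have hT : ∀ x y, inner ℝ (T x) y = a x y := by
    intro x y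
    simp [T]
  have hS : T.IsSymmetric := by
    intro x y
    rw [hT, real_inner_comm, hT, ha]
  refine ⟨(hS.eigenvectorBasis rfl).toBasis, hS.eigenvalues rfl, ?_, ?_⟩
  · intro i j
    rw [← hin]
    have := orthonormal_iff_ite.1 (hS.eigenvectorBasis rfl).orthonormal i j
    simpa using this
  · intro i j
    rw [← hT]
    simp only [OrthonormalBasis.coe_toBasis, LinearMap.IsSymmetric.apply_eigenvectorBasis]
    have := orthonormal_iff_ite.1 (hS.eigenvectorBasis rfl).orthonormal i j
    rw [real_inner_smul_left, this]
    simp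

lemma kr_ball {n : ℕ} (hn : 1 ≤ n) (r : ℝ) (hr : 0 < r) :
    ∫ x in Metric.ball (0 : EuclideanSpace ℝ (Fin n)) r, ‖x‖ ^ 2 =
      (n : ℝ) / (n + 2) * (volume (Metric.ball (0 : EuclideanSpace ℝ (Fin n)) 1)).toReal * r ^ (n + 2) := by
  have : Nonempty (Fin n) := ⟨⟨0, hn⟩⟩
  have h1 : ∫ x in Metric.ball (0 : EuclideanSpace ℝ (Fin n)) r, ‖x‖ ^ 2 =
      ∫ x : EuclideanSpace ℝ (Fin n), (Set.Iio r).indicator (fun t => t ^ 2) ‖x‖ := by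
    rw [← integral_indicator measurableSet_ball]
    congr 1
    ext x
    simp [Set.indicator]
  rw [h1, integral_fun_norm_addHaar]
  have h2 : ∫ y in Set.Ioi (0 : ℝ), y ^ (Module.finrank ℝ (EuclideanSpace ℝ (Fin n)) - 1) •
      (Set.Iio r).indicator (fun t => t ^ 2) y = r ^ (n + 2) / (n + 2) := by
    rw [finrank_euclideanSpace_fin]
    have h3 : ∀ y : ℝ, y ^ (n - 1) • (Set.Iio r).indicator (fun t => t ^ 2) y =
      (Set.Iio r).indicator (fun t => t ^ (n + 1)) y := by
      intro y
      simp only [Set.indicator]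
      split_ifs
      · rw [smul_eq_mul, ← pow_add]; congr 1; omega
      · simp
    simp_rw [h3]
    rw [setIntegral_indicator measurableSet_Iio, Set.Ioi_inter_Iio, ← integral_Ioc_eq_integral_Ioo,
      ← intervalIntegral.integral_of_le hr.le, integral_pow]
    push_cast
    ring_nf
  rw [h2]
  simp [Measure.real]
  ring

lemma kr_abs {W : Type*} [AddCommGroup W] [Module ℝ W] [FiniteDimensional ℝ W]
    (a b : W →ₗ[ℝ] W →ₗ[ℝ] ℝ) (ha : ∀ x y, a x y = a y x) (hb : ∀ x y, b x y = b y x)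
    (ha0 : ∀ x, 0 ≤ a x x)
    (hb0 : ∀ x, 0 ≤ b x x) (hb1 : ∀ x, b x x = 0 → x = 0) (t : ℝ) (k : ℕ)
    (h : ∀ V : Submodule ℝ W, Module.finrank ℝ V = k + 1 → ∃ x ∈ V, t * b x x < a x x) :
    ∃ φ : Fin k → W, (∀ j, b (φ j) (φ j) ≤ 1) ∧
      ∀ x, t * b x x - a x x ≤ t * ∑ j, (b (φ j) x) ^ 2 := by
  classical
  obtain ⟨e, l, hbe, hae⟩ := kr_diag a b ha hb hb0 hb1
  have hbx : ∀ i x, b (e i) x = e.repr x i := by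
    intro i x
    conv_lhs => rw [← e.sum_repr x]
    simp only [map_sum, map_smul, hbe, smul_eq_mul]
    simp
  have hax : ∀ i x, a (e i) x = l i * e.repr x i := by
    intro i x
    conv_lhs => rw [← e.sum_repr x]
    simp only [map_sum, map_smul, hae, smul_eq_mul]
    simp [mul_comm]
  have hbb : ∀ x, b x x = ∑ i, (e.repr x i) ^ 2 := by
    intro x
    have : b x x = b (∑ i, e.repr x i • e i) x := by rw [e.sum_repr x]
    rw [this]
    simp only [map_sum, map_smul, LinearMap.sum_apply, LinearMap.smul_apply, hbx, smul_eq_mul, pow_two]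
  have haa : ∀ x, a x x = ∑ i, l i * (e.repr x i) ^ 2 := by
    intro x
    have : a x x = a (∑ i, e.repr x i • e i) x := by rw [e.sum_repr x]
    rw [this]
    simp only [map_sum, map_smul, LinearMap.sum_apply, LinearMap.smul_apply, hax, smul_eq_mul]
    refine Finset.sum_congr rfl fun i _ => by ring
  have hl0 : ∀ i, 0 ≤ l i := by
    intro i
    have := ha0 (e i)
    rwa [hae, if_pos rfl] at this
  set S : Finset (Fin (Module.finrank ℝ W)) := Finset.univ.filter (fun i => l i < t) with hS
  have hcard : S.card ≤ k := by
    by_contra hc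
    push Not at hc
    obtain ⟨s, hs, hsc⟩ := Finset.exists_subset_card_eq (Nat.succ_le_of_lt hc)
    obtain ⟨x, hx, hlt⟩ := h (Submodule.span ℝ (e '' (s : Set _))) (by
      have : e '' (s : Set _) = Set.range (fun i : s => e i) := by
        ext y; simp
      rw [this, finrank_span_eq_card (b := fun i : s => e i)]
      · simp [hsc]
      · exact e.linearIndependent.comp _ Subtype.val_injective)
    rw [Module.Basis.mem_span_image] at hx
    rw [hbb, haa, Finset.mul_sum] at hlt
    refine absurd hlt (not_lt.2 (Finset.sum_le_sum fun i _ => ?_))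
    by_cases hi : e.repr x i = 0
    · simp [hi]
    · have h1 : i ∈ s := hx (by simpa using hi)
      have h2 : l i < t := by simpa [hS] using hs h1
      gcongr
  have hemb : Nonempty (S ↪ Fin k) := by
    apply Function.Embedding.nonempty_of_card_le
    simpa using hcard
  obtain ⟨ι⟩ := hemb
  refine ⟨Function.extend ι (fun i : S => e i) 0, ?_, ?_⟩
  · intro j
    by_cases hj : ∃ i, ι i = j
    · obtain ⟨i, rfl⟩ := hj
      rw [ι.injective.extend_apply, hbe]
      simp
    · rw [Function.extend_apply' _ _ _ hj]
      simp
  · intro x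
    have hsum : ∑ j, (b (Function.extend ι (fun i : S => e i) 0 j) x) ^ 2
        = ∑ i ∈ S, (e.repr x i) ^ 2 := by
      rw [← Finset.sum_coe_sort S]
      symm
      apply Fintype.sum_of_injective ι ι.injective
      · intro j hj
        rw [Function.extend_apply' _ _ _ (by simpa using hj)]
        simp
      · intro i
        rw [ι.injective.extend_apply, hbx]
    rw [hsum, hbb, haa, Finset.mul_sum, ← Finset.sum_sub_distrib, Finset.mul_sum, hS, Finset.sum_filter]
    refine Finset.sum_le_sum fun i _ => ?_
    split_ifs with hi
    · have := mul_nonneg (hl0 i) (sq_nonneg (e.repr x i))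
      linarith
    · push Not at hi
      have := mul_le_mul_of_nonneg_right hi (sq_nonneg (e.repr x i))
      linarith

/-- The space of real-analytic functions on `ℝⁿ`. -/
def krA (n : ℕ) : Submodule ℝ (EuclideanSpace ℝ (Fin n) → ℝ) where
  carrier := {f | AnalyticOnNhd ℝ f Set.univ}
  add_mem' := fun hf hg => hf.add hg
  zero_mem' := fun _ _ => analyticAt_const
  smul_mem' := fun c _ hf => (analyticOnNhd_const (v := c)).smul hf

lemma krA_contDiff {n : ℕ} (f : krA n) : ContDiff ℝ (⊤ : ℕ∞) f.1 :=
  AnalyticOnNhd.contDiff f.2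

lemma krA_cont {n : ℕ} (f : krA n) : Continuous f.1 := (krA_contDiff f).continuous

lemma krA_grad_cont {n : ℕ} (f : krA n) : Continuous (fun x => fderiv ℝ f.1 x) :=
  (krA_contDiff f).continuous_fderiv (by simp)

lemma krA_diff {n : ℕ} (f : krA n) : Differentiable ℝ f.1 :=
  (krA_contDiff f).differentiable (by simp)

lemma kr_int {n : ℕ} {F : Type*} [NormedAddCommGroup F] {Ω : Set (EuclideanSpace ℝ (Fin n))}
    (hΩb : Bornology.IsBounded Ω)
    {f : EuclideanSpace ℝ (Fin n) → F} (hf : Continuous f) : IntegrableOn f Ω :=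
  (hf.continuousOn.integrableOn_compact hΩb.isCompact_closure).mono_set subset_closure

lemma kr_b {n : ℕ} {Ω : Set (EuclideanSpace ℝ (Fin n))} (hΩb : Bornology.IsBounded Ω) :
    ∃ b : krA n →ₗ[ℝ] krA n →ₗ[ℝ] ℝ, ∀ f g, b f g = ∫ x in Ω, f.1 x * g.1 x := by
  have hI : ∀ f g : krA n, IntegrableOn (fun x => f.1 x * g.1 x) Ω := fun f g =>
    kr_int hΩb ((krA_cont f).mul (krA_cont g))
  refine ⟨LinearMap.mk₂ ℝ (fun f g => ∫ x in Ω, f.1 x * g.1 x) ?_ ?_ ?_ ?_, fun f g => rfl⟩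
  · intro f f' g
    rw [← integral_add (hI f g)
      (hI f' g)]
    simp [add_mul]
  · intro c f g
    rw [smul_eq_mul, ← integral_const_mul]
    simp [mul_assoc]
  · intro g f f'
    rw [← integral_add (hI g f)
      (hI g f')]
    simp [mul_add]
  · intro c f g
    rw [smul_eq_mul, ← integral_const_mul]
    simp [mul_left_comm]

lemma kr_a {n : ℕ} {Ω : Set (EuclideanSpace ℝ (Fin n))} (hΩb : Bornology.IsBounded Ω) :
    ∃ a : krA n →ₗ[ℝ] krA n →ₗ[ℝ] ℝ, (∀ f g, a f g = a g f) ∧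
      ∀ f, a f f = ∫ x in Ω, ‖fderiv ℝ f.1 x‖ ^ 2 := by
  let G : krA n → EuclideanSpace ℝ (Fin n) → EuclideanSpace ℝ (Fin n) := fun f x =>
    (InnerProductSpace.toDual ℝ (EuclideanSpace ℝ (Fin n))).symm (fderiv ℝ f.1 x)
  have hGc : ∀ f, Continuous (G f) := fun f =>
    (InnerProductSpace.toDual ℝ (EuclideanSpace ℝ (Fin n))).symm.continuous.comp (krA_grad_cont f)
  have hGa : ∀ f g x, G (f + g) x = G f x + G g x := by
    intro f g x
    simp only [G]
    rw [← map_add, ← fderiv_add (krA_diff f x) (krA_diff g x)]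
    rfl
  have hGs : ∀ (c : ℝ) f x, G (c • f) x = c • G f x := by
    intro c f x
    simp only [G]
    have h1 : fderiv ℝ (c • f : krA n).1 x = c • fderiv ℝ f.1 x :=
      fderiv_const_smul (krA_diff f x) c
    rw [h1]
    simp
  refine ⟨LinearMap.mk₂ ℝ (fun f g => ∫ x in Ω, inner ℝ (G f x) (G g x)) ?_ ?_ ?_ ?_, ?_, ?_⟩
  · intro f f' g
    rw [← integral_add (kr_int hΩb ((hGc f).inner (hGc g)))
      (kr_int hΩb ((hGc f').inner (hGc g)))]
    simp [hGa, inner_add_left]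
  · intro c f g
    rw [smul_eq_mul, ← integral_const_mul]
    simp [hGs, real_inner_smul_left]
  · intro g f f'
    rw [← integral_add (kr_int hΩb ((hGc g).inner (hGc f)))
      (kr_int hΩb ((hGc g).inner (hGc f')))]
    simp [hGa, inner_add_right]
  · intro c f g
    rw [smul_eq_mul, ← integral_const_mul]
    simp [hGs, real_inner_smul_right]
  · intro f g
    simp only [LinearMap.mk₂_apply]
    simp_rw [real_inner_comm]
  · intro f
    simp only [LinearMap.mk₂_apply]
    simp [G]

lemma kr_pos {n : ℕ} {Ω : Set (EuclideanSpace ℝ (Fin n))} (hΩo : IsOpen Ω)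
    (hΩn : Ω.Nonempty) (hΩb : Bornology.IsBounded Ω) (f : krA n)
    (h : ∫ x in Ω, f.1 x * f.1 x = 0) : f = 0 := by
  have hc : Continuous (fun x => f.1 x * f.1 x) := (krA_cont f).mul (krA_cont f)
  rw [integral_eq_zero_iff_of_nonneg (fun x => mul_self_nonneg _) (kr_int hΩb hc)] at h
  have h2 := Measure.eqOn_open_of_ae_eq h hΩo hc.continuousOn continuousOn_const
  obtain ⟨z, hz⟩ := hΩn
  have h3 : f.1 =ᶠ[nhds z] 0 := by
    filter_upwards [hΩo.mem_nhds hz] with x hx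
    have := h2 hx
    simpa using this
  have h4 := f.2.eqOn_zero_of_preconnected_of_eventuallyEq_zero isPreconnected_univ
    (Set.mem_univ z) h3
  ext x
  exact h4 (Set.mem_univ x)

lemma kr_fin {n : ℕ} {Ω : Set (EuclideanSpace ℝ (Fin n))} (hΩo : IsOpen Ω)
    (hΩn : Ω.Nonempty) (hΩb : Bornology.IsBounded Ω) (k : ℕ) (t : ℝ) (ht0 : 0 ≤ t)
    (ht : t < neumannEigenvalue n k Ω) (u : Finset (krA n)) :
    ∃ φ : Fin k → krA n, (∀ j, ∫ x in Ω, (φ j).1 x * (φ j).1 x ≤ 1) ∧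
      ∀ f ∈ u, t * (∫ x in Ω, f.1 x * f.1 x) - ∫ x in Ω, ‖fderiv ℝ f.1 x‖ ^ 2 ≤
        t * ∑ j, (∫ x in Ω, (φ j).1 x * f.1 x) ^ 2 := by
  obtain ⟨b, hb⟩ := kr_b hΩb
  obtain ⟨a, has, ha⟩ := kr_a hΩb
  have hbs : ∀ f g, b f g = b g f := fun f g => by simp [hb, mul_comm]
  have hb0 : ∀ f, 0 ≤ b f f := fun f => by
    rw [hb]; exact integral_nonneg fun x => mul_self_nonneg _
  have ha0 : ∀ f, 0 ≤ a f f := fun f => by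
    rw [ha]; exact integral_nonneg fun x => sq_nonneg _
  let W : Submodule ℝ (krA n) := Submodule.span ℝ (u : Set (krA n))
  have : FiniteDimensional ℝ W := FiniteDimensional.span_finset ℝ u
  obtain ⟨φ, h1, h2⟩ := kr_abs (W := W) (a.domRestrict₁₂ W W) (b.domRestrict₁₂ W W)
    (fun x y => has _ _) (fun x y => hbs _ _) (fun x => ha0 _) (fun x => hb0 _)
    (fun x hx => by
      have := kr_pos hΩo hΩn hΩb x.1 (by rw [← hb]; exact hx)
      exact Subtype.ext this) t k (by
      intro V hV
      by_contra hcon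
      push Not at hcon
      refine absurd ht (not_lt.2 ?_)
      let V' : Submodule ℝ (EuclideanSpace ℝ (Fin n) → ℝ) := (V.map W.subtype).map (krA n).subtype
      have hmem : ∀ f ∈ V', ∃ g : krA n, g.1 = f ∧ ∫ x in Ω, ‖fderiv ℝ f x‖ ^ 2 ≤
          t * ∫ x in Ω, f x * f x := by
        rintro f ⟨g, ⟨w, hw, rfl⟩, rfl⟩
        refine ⟨w, rfl, ?_⟩
        have h3 : a w.1 w.1 ≤ t * b w.1 w.1 := hcon w hw
        rwa [ha, hb] at h3
      unfold neumannEigenvalue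
      refine (ciInf_le ⟨0, ?_⟩ ⟨V', ?_, ?_, ?_⟩).trans ?_
      · rintro _ ⟨V, rfl⟩
        refine Real.iSup_nonneg fun f => ?_
        exact div_nonneg (integral_nonneg fun x => sq_nonneg _) (integral_nonneg fun x => sq_nonneg _)
      · refine Real.iSup_le ?_ ht0
        rintro ⟨f, hf, -⟩
        obtain ⟨g, -, hg⟩ := hmem f hf
        refine div_le_of_le_mul₀ (integral_nonneg fun x => sq_nonneg _) ht0 ?_
        simpa [pow_two] using hg
      · rw [← hV]
        rw [Submodule.finrank_map_subtype_eq, Submodule.finrank_map_subtype_eq]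
      · intro f hf
        obtain ⟨g, rfl, -⟩ := hmem f hf
        exact krA_contDiff g
      · intro f hf h0
        obtain ⟨g, rfl, -⟩ := hmem f hf
        have : g = 0 := kr_pos hΩo hΩn hΩb g (by
          apply setIntegral_eq_zero_of_forall_eq_zero
          intro x hx; rw [h0 x hx]; simp)
        rw [this]; rfl)
  refine ⟨fun j => (φ j).1, fun j => ?_, fun f hf => ?_⟩
  · rw [← hb]; exact h1 j
  · have h3 : t * b f f - a f f ≤ t * ∑ j, (b (φ j).1 f) ^ 2 := h2 ⟨f, Submodule.subset_span hf⟩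
    simp only [ha, hb] at h3
    exact h3

lemma kr_cpt {n : ℕ} {Ω : Set (EuclideanSpace ℝ (Fin n))} (hΩo : IsOpen Ω)
    (hΩn : Ω.Nonempty) (hΩb : Bornology.IsBounded Ω) (k : ℕ) (t : ℝ) (ht0 : 0 ≤ t)
    (ht : t < neumannEigenvalue n k Ω) :
    ∃ g : Fin k → EuclideanSpace ℝ (Fin n) → ℝ,
      (∀ j, MemLp (g j) 2 (volume.restrict Ω) ∧ eLpNorm (g j) 2 (volume.restrict Ω) ≤ 1) ∧
      ∀ f : krA n, t * (∫ x in Ω, f.1 x * f.1 x) - ∫ x in Ω, ‖fderiv ℝ f.1 x‖ ^ 2 ≤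
        t * ∑ j, (∫ x in Ω, g j x * f.1 x) ^ 2 := by
  have hmem : ∀ f : krA n, MemLp f.1 2 (volume.restrict Ω) := by
    intro f
    rw [memLp_two_iff_integrable_sq (krA_cont f).aestronglyMeasurable]
    exact kr_int hΩb ((krA_cont f).pow 2)
  let H := Lp ℝ 2 ((volume : Measure (EuclideanSpace ℝ (Fin n))).restrict Ω)
  let i : krA n → H := fun f => (hmem f).toLp f.1
  have hi : ∀ (h : H) (f : krA n), inner ℝ h (i f) = ∫ x in Ω, h x * f.1 x := by
    intro h f
    rw [L2.inner_def]
    apply integral_congr_ae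
    filter_upwards [(hmem f).coeFn_toLp] with x hx
    simp only [i, hx]
    simp [mul_comm]
  have hii : ∀ (h f : krA n), inner ℝ (i h) (i f) = ∫ x in Ω, h.1 x * f.1 x := by
    intro h f
    rw [hi]
    apply integral_congr_ae
    filter_upwards [(hmem h).coeFn_toLp] with x hx
    simp only [i, hx]
  let K : Set (Fin k → WeakDual ℝ H) := Set.pi Set.univ
    (fun _ => WeakDual.toStrongDual ⁻¹' Metric.closedBall (0 : StrongDual ℝ H) 1)
  have hK : IsCompact K := isCompact_univ_pi fun _ => WeakDual.isCompact_closedBall 0 1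
  let C : krA n → Set (Fin k → WeakDual ℝ H) := fun f =>
    {Φ | t * (∫ x in Ω, f.1 x * f.1 x) - ∫ x in Ω, ‖fderiv ℝ f.1 x‖ ^ 2 ≤
        t * ∑ j, (Φ j (i f)) ^ 2}
  have hC : ∀ f, IsClosed (C f) := by
    intro f
    refine isClosed_le continuous_const (continuous_const.mul (continuous_finsetSum _ fun j _ => ?_))
    exact ((WeakDual.eval_continuous (i f)).comp (continuous_apply j)).pow 2
  obtain ⟨Φ, hΦK, hΦC⟩ := hK.inter_iInter_nonempty C hC (by
    intro u
    obtain ⟨φ, h1, h2⟩ := kr_fin hΩo hΩn hΩb k t ht0 ht u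
    refine ⟨fun j => StrongDual.toWeakDual (InnerProductSpace.toDual ℝ H (i (φ j))), ?_, ?_⟩
    · intro j _
      simp only [Set.mem_preimage, StrongDual.toStrongDual_toWeakDual, mem_closedBall_zero_iff,
        LinearIsometryEquiv.norm_map]
      have h3 : ‖i (φ j)‖ ^ 2 ≤ 1 := by
        rw [← real_inner_self_eq_norm_sq, hii]; exact h1 j
      exact (sq_le_one_iff₀ (norm_nonneg _)).1 h3
    · simp only [Set.mem_iInter]
      intro f hf
      have := h2 f hf
      simp only [C, Set.mem_ofPred_eq]
      convert this using 5 with j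
      rw [← hii]
      rfl)
  have hΦn : ∀ j, ‖(InnerProductSpace.toDual ℝ H).symm (WeakDual.toStrongDual (Φ j))‖ ≤ 1 := by
    intro j
    rw [LinearIsometryEquiv.norm_map]
    have := hΦK j (Set.mem_univ j)
    simpa using this
  refine ⟨fun j => ((InnerProductSpace.toDual ℝ H).symm (WeakDual.toStrongDual (Φ j)) : H), ?_, ?_⟩
  · intro j
    refine ⟨Lp.memLp _, ?_⟩
    have := hΦn j
    rw [Lp.norm_def] at this
    rw [← ENNReal.ofReal_one]
    exact (ENNReal.le_ofReal_iff_toReal_le (Lp.memLp _).2.ne zero_le_one).2 this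
  · intro f
    have := Set.mem_iInter.1 hΦC f
    simp only [C, Set.mem_ofPred_eq] at this
    simp_rw [← hi, InnerProductSpace.toDual_symm_apply]
    exact this

section final
open scoped FourierTransform ENNReal

lemma kr_four {n : ℕ} {Ω : Set (EuclideanSpace ℝ (Fin n))} (hΩo : IsOpen Ω)
    (g : EuclideanSpace ℝ (Fin n) → ℝ) (hg : IntegrableOn g Ω) (ξ : EuclideanSpace ℝ (Fin n)) :
    ‖𝓕 (Ω.indicator (fun x => (g x : ℂ))) ξ‖ ^ 2 =
      (∫ x in Ω, g x * Real.cos (2 * Real.pi * inner ℝ x ξ)) ^ 2 +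
      (∫ x in Ω, g x * Real.sin (2 * Real.pi * inner ℝ x ξ)) ^ 2 := by
  have hc : IntegrableOn (fun x => g x * Real.cos (2 * Real.pi * inner ℝ x ξ)) Ω := by
    refine hg.mul_bdd (c := 1) (by fun_prop) (.of_forall fun x => ?_)
    simpa using Real.abs_cos_le_one _
  have hs : IntegrableOn (fun x => g x * Real.sin (2 * Real.pi * inner ℝ x ξ)) Ω := by
    refine hg.mul_bdd (c := 1) (by fun_prop) (.of_forall fun x => ?_)
    simpa using Real.abs_sin_le_one _
  have h1 : 𝓕 (Ω.indicator (fun x => (g x : ℂ))) ξ =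
      ((∫ x in Ω, g x * Real.cos (2 * Real.pi * inner ℝ x ξ) : ℝ) : ℂ) -
      ((∫ x in Ω, g x * Real.sin (2 * Real.pi * inner ℝ x ξ) : ℝ) : ℂ) * Complex.I := by
    rw [Real.fourier_eq']
    have h2 : ∀ v : EuclideanSpace ℝ (Fin n),
        Complex.exp (↑(-2 * Real.pi * inner ℝ v ξ) * Complex.I) • Ω.indicator (fun x => (g x : ℂ)) v
        = Ω.indicator (fun v => ((g v * Real.cos (2 * Real.pi * inner ℝ v ξ) : ℝ) : ℂ) -
          ((g v * Real.sin (2 * Real.pi * inner ℝ v ξ) : ℝ) : ℂ) * Complex.I) v := by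
      intro v
      by_cases hv : v ∈ Ω
      · simp only [Set.indicator_of_mem hv, smul_eq_mul]
        rw [Complex.exp_mul_I, ← Complex.ofReal_cos, ← Complex.ofReal_sin]
        have : -2 * Real.pi * inner ℝ v ξ = -(2 * Real.pi * inner ℝ v ξ) := by ring
        rw [this, Real.cos_neg, Real.sin_neg]
        push_cast
        ring
      · simp [Set.indicator_of_notMem hv]
    simp_rw [h2]
    rw [integral_indicator hΩo.measurableSet, integral_sub hc.ofReal (hs.ofReal.mul_const _),
      integral_mul_const, integral_complex_ofReal, integral_complex_ofReal]
  rw [h1, ← Complex.normSq_eq_norm_sq, Complex.normSq_apply]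
  simp
  ring

lemma kr_wave {n : ℕ} {Ω : Set (EuclideanSpace ℝ (Fin n))} (hΩo : IsOpen Ω)
    (hΩb : Bornology.IsBounded Ω) (k : ℕ) (t : ℝ)
    (g : Fin k → EuclideanSpace ℝ (Fin n) → ℝ) (hg : ∀ j, IntegrableOn (g j) Ω)
    (h : ∀ f : krA n, t * (∫ x in Ω, f.1 x * f.1 x) - ∫ x in Ω, ‖fderiv ℝ f.1 x‖ ^ 2 ≤
        t * ∑ j, (∫ x in Ω, g j x * f.1 x) ^ 2) (ξ : EuclideanSpace ℝ (Fin n)) :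
    (volume Ω).toReal * (t - (2 * Real.pi) ^ 2 * ‖ξ‖ ^ 2) ≤
      t * ∑ j, ‖𝓕 (Ω.indicator (fun x => (g j x : ℂ))) ξ‖ ^ 2 := by
  have hinn : ∀ x, HasFDerivAt (fun x : EuclideanSpace ℝ (Fin n) => 2 * Real.pi * inner ℝ x ξ)
      ((2 * Real.pi) • innerSL ℝ ξ) x := by
    intro x
    have := ((innerSL ℝ ξ).hasFDerivAt (x := x)).const_mul (2 * Real.pi)
    simpa [real_inner_comm] using this
  have hana : AnalyticOnNhd ℝ (fun x : EuclideanSpace ℝ (Fin n) => 2 * Real.pi * inner ℝ x ξ)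
      Set.univ := by
    intro x _
    have : AnalyticAt ℝ (fun x => ((2 * Real.pi) • innerSL ℝ ξ) x) x :=
      ((2 * Real.pi) • innerSL ℝ ξ).analyticAt x
    simpa [real_inner_comm] using this
  let fc : krA n := ⟨fun x => Real.cos (2 * Real.pi * inner ℝ x ξ),
    fun x hx => Real.analyticAt_cos.comp (hana x hx)⟩
  let fs : krA n := ⟨fun x => Real.sin (2 * Real.pi * inner ℝ x ξ),
    fun x hx => Real.analyticAt_sin.comp (hana x hx)⟩
  have hdc : ∀ x, ‖fderiv ℝ fc.1 x‖ ^ 2 =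
      (2 * Real.pi) ^ 2 * ‖ξ‖ ^ 2 * Real.sin (2 * Real.pi * inner ℝ x ξ) ^ 2 := by
    intro x
    rw [((hinn x).cos).fderiv, norm_smul, norm_smul, innerSL_apply_norm, mul_pow, mul_pow]
    simp only [Real.norm_eq_abs, sq_abs]
    ring
  have hds : ∀ x, ‖fderiv ℝ fs.1 x‖ ^ 2 =
      (2 * Real.pi) ^ 2 * ‖ξ‖ ^ 2 * Real.cos (2 * Real.pi * inner ℝ x ξ) ^ 2 := by
    intro x
    rw [((hinn x).sin).fderiv, norm_smul, norm_smul, innerSL_apply_norm, mul_pow, mul_pow]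
    simp only [Real.norm_eq_abs, sq_abs]
    ring
  have e1 : (∫ x in Ω, fc.1 x * fc.1 x) + ∫ x in Ω, fs.1 x * fs.1 x = (volume Ω).toReal := by
    rw [← integral_add]
    · have : ∀ x, fc.1 x * fc.1 x + fs.1 x * fs.1 x = 1 := by
        intro x
        simp only [fc, fs]
        nlinarith [Real.sin_sq_add_cos_sq (2 * Real.pi * inner ℝ x ξ)]
      simp_rw [this]
      simp [Measure.real]
    · exact kr_int hΩb ((krA_cont fc).mul (krA_cont fc))
    · exact kr_int hΩb ((krA_cont fs).mul (krA_cont fs))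
  have e2 : (∫ x in Ω, ‖fderiv ℝ fc.1 x‖ ^ 2) + ∫ x in Ω, ‖fderiv ℝ fs.1 x‖ ^ 2 =
      (volume Ω).toReal * ((2 * Real.pi) ^ 2 * ‖ξ‖ ^ 2) := by
    rw [← integral_add]
    · have : ∀ x, ‖fderiv ℝ fc.1 x‖ ^ 2 + ‖fderiv ℝ fs.1 x‖ ^ 2 =
          (2 * Real.pi) ^ 2 * ‖ξ‖ ^ 2 := by
        intro x
        rw [hdc, hds, ← mul_add, Real.sin_sq_add_cos_sq, mul_one]
      simp_rw [this]
      simp [Measure.real]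
    · exact kr_int hΩb ((krA_grad_cont fc).norm.pow 2)
    · exact kr_int hΩb ((krA_grad_cont fs).norm.pow 2)
  have h1 := h fc
  have h2 := h fs
  simp_rw [kr_four hΩo _ (hg _)]
  rw [Finset.sum_add_distrib, mul_sub, ← e2, ← e1]
  simp only [fc, fs] at h1 h2 ⊢
  linarith

lemma kr_bessel {n : ℕ} {Ω : Set (EuclideanSpace ℝ (Fin n))} (hΩo : IsOpen Ω)
    (g : EuclideanSpace ℝ (Fin n) → ℝ) (hg : IntegrableOn g Ω)
    (hg2 : MemLp g 2 (volume.restrict Ω)) (hg1 : eLpNorm g 2 (volume.restrict Ω) ≤ 1)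
    (B : Set (EuclideanSpace ℝ (Fin n))) :
    IntegrableOn (fun ξ => ‖𝓕 (Ω.indicator (fun x => (g x : ℂ))) ξ‖ ^ 2) B ∧
    ∫ ξ in B, ‖𝓕 (Ω.indicator (fun x => (g x : ℂ))) ξ‖ ^ 2 ≤ 1 := by
  set G : EuclideanSpace ℝ (Fin n) → ℂ := Ω.indicator (fun x => (g x : ℂ)) with hG
  have hG1 : Integrable G := by
    rw [hG, integrable_indicator_iff hΩo.measurableSet]
    exact hg.ofReal
  have hG2 : MemLp G 2 volume := by
    rw [hG, memLp_indicator_iff_restrict hΩo.measurableSet]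
    exact hg2.ofReal
  have hn : eLpNorm G 2 volume ≤ 1 := by
    rw [hG, eLpNorm_indicator_eq_eLpNorm_restrict hΩo.measurableSet]
    refine le_trans (le_of_eq ?_) hg1
    apply eLpNorm_congr_norm_ae
    exact .of_forall fun x => by simp
  have hP := kr_planch G hG1 hG2
  have hcont : Continuous (𝓕 G) :=
    VectorFourier.fourierIntegral_continuous Real.continuous_fourierChar continuous_inner hG1
  have hF : MemLp (𝓕 G) 2 volume := ⟨hcont.aestronglyMeasurable, by rw [hP]; exact hG2.2⟩
  have hFi : Integrable (fun ξ => ‖𝓕 G ξ‖ ^ 2) :=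
    (memLp_two_iff_integrable_sq_norm hcont.aestronglyMeasurable).1 hF
  refine ⟨hFi.integrableOn, ?_⟩
  refine (setIntegral_le_integral hFi (.of_forall fun x => sq_nonneg _)).trans ?_
  have h1 : eLpNorm (𝓕 G) 2 volume ≤ 1 := hP ▸ hn
  rw [hF.eLpNorm_eq_integral_rpow_norm (by norm_num) (by norm_num), ← ENNReal.ofReal_one,
    ENNReal.ofReal_le_ofReal_iff zero_le_one] at h1
  simp only [ENNReal.toReal_ofNat, Real.rpow_ofNat] at h1
  have h0 : 0 ≤ ∫ ξ, ‖𝓕 G ξ‖ ^ 2 := integral_nonneg fun x => sq_nonneg _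
  by_contra hc
  push Not at hc
  exact absurd h1 (not_le.2 (Real.one_lt_rpow hc (by norm_num)))

lemma kr_bound {n : ℕ} (hn : 1 ≤ n) {Ω : Set (EuclideanSpace ℝ (Fin n))} (hΩo : IsOpen Ω)
    (hΩn : Ω.Nonempty) (hΩb : Bornology.IsBounded Ω) (k : ℕ) (t : ℝ) (ht0 : 0 ≤ t)
    (ht : t < neumannEigenvalue n k Ω) (r : ℝ) (hr : 0 < r) :
    t * ((volume (Metric.ball (0 : EuclideanSpace ℝ (Fin n)) 1)).toReal * (volume Ω).toReal * r ^ n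
      - k) ≤ (2 * Real.pi) ^ 2 * ((n : ℝ) / (n + 2)) *
      ((volume (Metric.ball (0 : EuclideanSpace ℝ (Fin n)) 1)).toReal * (volume Ω).toReal * r ^ n)
        * r ^ 2 := by
  obtain ⟨g, hg, h⟩ := kr_cpt hΩo hΩn hΩb k t ht0 ht
  have hfin : IsFiniteMeasure (volume.restrict Ω) :=
    ⟨by rw [Measure.restrict_apply_univ]; exact hΩb.measure_lt_top⟩
  have hgi : ∀ j, IntegrableOn (g j) Ω := fun j => (hg j).1.integrable (by norm_num)
  have hw := kr_wave hΩo hΩb k t g hgi h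
  have hB := fun j => kr_bessel hΩo (g j) (hgi j) (hg j).1 (hg j).2
    (Metric.ball (0 : EuclideanSpace ℝ (Fin n)) r)
  have hc1 : IntegrableOn (fun _ : EuclideanSpace ℝ (Fin n) => t)
      (Metric.ball (0 : EuclideanSpace ℝ (Fin n)) r) :=
    kr_int Metric.isBounded_ball continuous_const
  have hc2 : IntegrableOn (fun ξ : EuclideanSpace ℝ (Fin n) => (2 * Real.pi) ^ 2 * ‖ξ‖ ^ 2)
      (Metric.ball (0 : EuclideanSpace ℝ (Fin n)) r) :=
    kr_int Metric.isBounded_ball (by fun_prop)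
  have hI := integral_mono (μ := volume.restrict (Metric.ball (0 : EuclideanSpace ℝ (Fin n)) r))
    ((hc1.sub hc2).const_mul _)
    ((integrable_finsetSum Finset.univ fun j _ => (hB j).1).const_mul t) hw
  have : Nonempty (Fin n) := ⟨⟨0, hn⟩⟩
  have hball : (volume (Metric.ball (0 : EuclideanSpace ℝ (Fin n)) r)).toReal =
      r ^ n * (volume (Metric.ball (0 : EuclideanSpace ℝ (Fin n)) 1)).toReal := by
    have := Measure.addHaar_ball (volume : Measure (EuclideanSpace ℝ (Fin n))) 0 hr.le
    rw [this, ENNReal.toReal_mul, ENNReal.toReal_ofReal (by positivity), finrank_euclideanSpace_fin]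
  have hL : ∫ ξ in Metric.ball (0 : EuclideanSpace ℝ (Fin n)) r,
      (volume Ω).toReal * (t - (2 * Real.pi) ^ 2 * ‖ξ‖ ^ 2) = (volume Ω).toReal *
      (t * (r ^ n * (volume (Metric.ball (0 : EuclideanSpace ℝ (Fin n)) 1)).toReal) -
        (2 * Real.pi) ^ 2 * ((n : ℝ) / (n + 2) *
          (volume (Metric.ball (0 : EuclideanSpace ℝ (Fin n)) 1)).toReal * r ^ (n + 2))) := by
    rw [integral_const_mul, integral_sub hc1 hc2, integral_const_mul, kr_ball hn r hr,
      setIntegral_const, Measure.real, hball, smul_eq_mul]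
    ring
  have hR : ∫ ξ in Metric.ball (0 : EuclideanSpace ℝ (Fin n)) r,
      t * ∑ j, ‖𝓕 (Ω.indicator (fun x => (g j x : ℂ))) ξ‖ ^ 2 ≤ t * k := by
    rw [integral_const_mul, integral_finsetSum _ fun j _ => (hB j).1]
    refine mul_le_mul_of_nonneg_left ?_ ht0
    refine (Finset.sum_le_sum fun j _ => (hB j).2).trans ?_
    simp
  have := hI.trans hR
  simp only [Pi.sub_apply] at this
  rw [hL] at this
  rw [pow_add] at this
  linarith

end final

/-- Kröger's inequality: for a bounded domain `Ω ⊆ ℝⁿ` with Lipschitz boundary and any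
`k ≥ 1`, `μ_k(Ω) ≤ (2π)² · ((n+2)/2)^(2/n) · (k/(ωₙ · vol Ω))^(2/n)`, where `ωₙ` is the
volume of the unit ball in `ℝⁿ`. -/
theorem kroger_inequality {n : ℕ} (hn : 1 ≤ n) (Ω : Set (EuclideanSpace ℝ (Fin n)))
    (hΩo : IsOpen Ω) (hΩconn : IsConnected Ω) (hΩb : Bornology.IsBounded Ω)
    (hΩl : HasLipschitzBoundary Ω) :
    ∀ k : ℕ, 1 ≤ k →
      neumannEigenvalue n k Ω ≤
        (2 * Real.pi) ^ 2 * (((n : ℝ) + 2) / 2) ^ ((2 : ℝ) / (n : ℝ)) *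
          ((k : ℝ) /
              ((volume (Metric.ball (0 : EuclideanSpace ℝ (Fin n)) 1)).toReal *
                (volume Ω).toReal)) ^ ((2 : ℝ) / (n : ℝ)) := by
  intro k hk
  set w := (volume (Metric.ball (0 : EuclideanSpace ℝ (Fin n)) 1)).toReal with hw
  set v := (volume Ω).toReal with hv
  have hwpos : 0 < w := ENNReal.toReal_pos (Metric.measure_ball_pos _ _ one_pos).ne'
    measure_ball_lt_top.ne
  have hvpos : 0 < v := ENNReal.toReal_pos (hΩo.measure_pos _ hΩconn.nonempty).ne'
    hΩb.measure_lt_top.ne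
  have hnpos : (0 : ℝ) < n := by exact_mod_cast hn
  have hkpos : (0 : ℝ) < k := by exact_mod_cast hk
  set q : ℝ := ((n : ℝ) + 2) / 2 * (k / (w * v)) with hq
  have hqpos : 0 < q := by positivity
  set r : ℝ := q ^ ((1 : ℝ) / n) with hr
  have hrpos : 0 < r := Real.rpow_pos_of_pos hqpos _
  have hrn : r ^ n = q := by
    rw [hr, ← Real.rpow_natCast, ← Real.rpow_mul hqpos.le, one_div,
      inv_mul_cancel₀ hnpos.ne', Real.rpow_one]
  have hr2 : r ^ 2 = (((n : ℝ) + 2) / 2) ^ ((2 : ℝ) / (n : ℝ)) *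
      ((k : ℝ) / (w * v)) ^ ((2 : ℝ) / (n : ℝ)) := by
    rw [← Real.mul_rpow (by positivity) (by positivity), ← hq, hr, ← Real.rpow_natCast,
      ← Real.rpow_mul hqpos.le]
    congr 1
    push_cast
    ring
  rw [mul_assoc, ← hr2]
  refine le_of_forall_lt fun t ht => ?_
  rcases lt_or_ge t 0 with h0 | h0
  · exact h0.trans_le (by positivity)
  obtain ⟨t', htt', ht'⟩ := exists_between ht
  refine lt_of_lt_of_le htt' ?_
  have hb := kr_bound hn hΩo hΩconn.nonempty hΩb k t' (h0.trans htt'.le) ht' r hrpos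
  rw [← hw, ← hv, hrn] at hb
  have e1 : w * v * q = ((n : ℝ) + 2) / 2 * k := by
    rw [hq]; field_simp
  rw [e1] at hb
  have e2 : ((n : ℝ) + 2) / 2 * k - k = n * k / 2 := by ring
  have e3 : (2 * Real.pi) ^ 2 * ((n : ℝ) / (n + 2)) * (((n : ℝ) + 2) / 2 * k) * r ^ 2 =
      ((2 * Real.pi) ^ 2 * r ^ 2) * (n * k / 2) := by
    field_simp
  rw [e2, e3] at hb
  exact le_of_mul_le_mul_right hb (by positivity)
end
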